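/- For any two partitions λ and μ, the symmetric function s_{sort₁(λ,μ)}·s_{sort₂(λ,μ)} − s_λ·s_μ is Schur nonnegative (the Fomin–Fulton–Li–Poon conjecture). -/

import Mathlib

/-- The complete homogeneous symmetric function `h_m` in `N` variables,
with `h_m = 0` for `m < 0`. -/
noncomputable def homog (N : ℕ) (m : ℤ) : MvPolynomial (Fin N) ℤ :=
  if 0 ≤ m then MvPolynomial.hsymm (Fin N) ℤ m.toNat else 0

/-- The skew Schur polynomial `s_{λ/μ}` in `N` variables, given by the
Jacobi–Trudi determinant `det (h_{λ_i - μ_j - i + j})_{i,j=1}^k`, where the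
partitions `lam`, `mu` are recorded 0-indexed (`lam 0 = λ_1`). -/
noncomputable def skewSchur (N k : ℕ) (lam mu : ℕ → ℕ) : MvPolynomial (Fin N) ℤ :=
  Matrix.det (Matrix.of fun i j : Fin k =>
    homog N ((lam i : ℤ) - (mu j : ℤ) - (i : ℤ) + (j : ℤ)))

/-- A symmetric polynomial is Schur nonnegative if it is a linear combination
with nonnegative coefficients of Schur polynomials `s_λ`. -/
def IsSchurNonneg (N : ℕ) (f : MvPolynomial (Fin N) ℤ) : Prop :=
  ∃ (m : ℕ) (c : Fin m → ℕ) (k : Fin m → ℕ) (lam : Fin m → ℕ → ℕ),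
    (∀ i, Antitone (lam i)) ∧ (∀ i j, k i ≤ j → lam i j = 0) ∧
    f = ∑ i, (c i : ℤ) • skewSchur N (k i) (lam i) (fun _ => 0)


namespace FFLP
open Finset

section Hrec
variable {R : Type*} [CommRing R]

/-- complete homogeneous polynomials in the first `n` of the variables `x 0, x 1, …` -/
def HN (x : ℕ → R) : ℕ → ℕ → R
  | 0, 0 => 1
  | 0, _ + 1 => 0
  | _ + 1, 0 => 1
  | n + 1, m + 1 => x n * HN x (n + 1) m + HN x n (m + 1)

def HZ (x : ℕ → R) (n : ℕ) (m : ℤ) : R := if 0 ≤ m then HN x n m.toNat else 0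

lemma HN_zero (x : ℕ → R) (n : ℕ) : HN x n 0 = 1 := by cases n <;> simp [HN]

lemma HZ_neg (x : ℕ → R) (n : ℕ) (m : ℤ) (h : m < 0) : HZ x n m = 0 := by
  unfold HZ; rw [if_neg (by omega)]

lemma HZ_zero (x : ℕ → R) (n : ℕ) : HZ x n 0 = 1 := by
  simp [HZ, HN_zero]

lemma HZ_zero_left (x : ℕ → R) (m : ℤ) : HZ x 0 m = if m = 0 then 1 else 0 := by
  unfold HZ
  split_ifs with h1 h2 h2
  · subst h2; simp [HN]
  · obtain ⟨k, hk⟩ : ∃ k, m.toNat = k + 1 := ⟨m.toNat - 1, by omega⟩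
    rw [hk]; simp [HN]
  · omega
  · rfl

lemma HZ_succ (x : ℕ → R) (n : ℕ) (m : ℤ) :
    HZ x (n + 1) m = x n * HZ x (n + 1) (m - 1) + HZ x n m := by
  rcases lt_trichotomy m 0 with h | h | h
  · rw [HZ_neg _ _ _ h, HZ_neg _ _ _ h, HZ_neg _ _ _ (by omega)]; simp
  · subst h; rw [HZ_zero, HZ_zero, HZ_neg _ _ _ (by omega)]; simp
  · unfold HZ
    rw [if_pos h.le, if_pos h.le, if_pos (by omega)]
    obtain ⟨k, hk⟩ : ∃ k, m.toNat = k + 1 := ⟨m.toNat - 1, by omega⟩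
    have : (m - 1).toNat = k := by omega
    rw [hk, this, HN]

lemma HZ_diff (x : ℕ → R) (n : ℕ) (p : ℤ) (d : ℕ) :
    HZ x (n + 1) p = x n ^ d * HZ x (n + 1) (p - d)
      + ∑ m ∈ Ioc (p - d) p, x n ^ (p - m).toNat * HZ x n m := by
  induction d with
  | zero => simp
  | succ d ih =>
    rw [ih, HZ_succ x n (p - d)]
    have : Ioc (p - ((d + 1 : ℕ) : ℤ)) p = insert (p - d) (Ioc (p - (d : ℤ)) p) := by
      ext a; simp only [mem_Ioc, mem_insert]; push_cast; omega
    rw [this, sum_insert (by simp)]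
    have e : (p - (p - (d : ℤ))).toNat = d := by omega
    have e2 : p - (d : ℤ) - 1 = p - ((d + 1 : ℕ) : ℤ) := by push_cast; ring
    rw [e, e2]; ring

/-- the Jacobi–Trudi type determinant at positions `p` -/
noncomputable def JT (x : ℕ → R) (n k : ℕ) (p : ℕ → ℤ) : R :=
  Matrix.det (Matrix.of fun i j : Fin k => HZ x n (p i + (j : ℕ)))

lemma det_row_op (k : ℕ) (A : ℕ → Fin k → R) (hA : A k = 0) (c : ℕ → R) :
    Matrix.det (Matrix.of fun i j : Fin k => A i j)
      = Matrix.det (Matrix.of fun i j : Fin k => A i j - c i * A (i + 1) j) := by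
  let U : Matrix (Fin k) (Fin k) R :=
    Matrix.of fun i j => if i = j then 1 else if (i : ℕ) + 1 = j then - c i else 0
  have hU : U.det = 1 := by
    rw [Matrix.det_of_isUpperTriangular]
    · simp [U]
    · intro i j hij
      simp only [id] at hij
      have h1 : i ≠ j := by rintro rfl; exact lt_irrefl _ hij
      have h2 : ¬ ((i : ℕ) + 1 = j) := by have := Fin.lt_def.1 hij; omega
      simp [U, h1, h2]
  rw [← one_mul (Matrix.det (Matrix.of fun i j : Fin k => A i j)), ← hU, ← Matrix.det_mul]
  congr 1
  ext i j
  rw [Matrix.mul_apply]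
  simp only [U, Matrix.of_apply]
  have : ∀ l : Fin k, (if i = l then (1 : R) else if (i : ℕ) + 1 = l then - c i else 0) * A l j
      = (if i = l then A i j else 0) + (if (i : ℕ) + 1 = l then - c i * A (i + 1) j else 0) := by
    intro l
    by_cases h1 : i = l
    · subst h1; simp
    · by_cases h2 : (i : ℕ) + 1 = l
      · simp [h1, h2]
      · simp [h1, h2]
  rw [sum_congr rfl (fun l _ => this l), sum_add_distrib]
  rw [sum_ite_eq]
  simp only [mem_univ, if_true]
  by_cases hi : (i : ℕ) + 1 < k
  · rw [sum_eq_single (⟨(i : ℕ) + 1, hi⟩ : Fin k)]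
    · simp; ring
    · intro b _ hb
      rw [if_neg]; intro h; exact hb (Fin.ext h.symm)
    · simp
  · have hik : (i : ℕ) + 1 = k := by omega
    rw [sum_eq_zero]
    · rw [hik, hA]; simp
    · intro l _
      rw [if_neg]; have := l.2; omega

lemma JT_branch (x : ℕ → R) (n k : ℕ) (p : ℕ → ℤ) (hp : ∀ i, i < k → p (i + 1) < p i)
    (hk : p k = - k) :
    JT x (n + 1) k p = ∑ m ∈ Fintype.piFinset (fun i : Fin k => Ioc (p (i + 1)) (p i)),
      (∏ i : Fin k, x n ^ (p i - m i).toNat)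
        * Matrix.det (Matrix.of fun i j : Fin k => HZ x n (m i + (j : ℕ))) := by
  unfold JT
  rw [det_row_op k (fun i j => HZ x (n + 1) (p i + (j : ℕ))) _
    (fun i => x n ^ (p i - p (i + 1)).toNat)]
  · have : (Matrix.of fun i j : Fin k => HZ x (n + 1) (p i + (j : ℕ)) -
        x n ^ (p i - p (i + 1)).toNat * HZ x (n + 1) (p (i + 1) + (j : ℕ)))
        = fun i : Fin k => ∑ m ∈ Ioc (p (i + 1)) (p i),
          (x n ^ (p i - m).toNat) • (fun j : Fin k => HZ x n (m + (j : ℕ))) := by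
      ext i j
      have h := hp i i.2
      have e := HZ_diff x n (p i + (j : ℕ)) (p i - p (i + 1)).toNat
      have e1 : p i + (j : ℕ) - ((p i - p (i + 1)).toNat : ℕ) = p (i + 1) + (j : ℕ) := by omega
      rw [e1] at e
      rw [Matrix.of_apply, e, Finset.sum_apply, add_sub_cancel_left]
      symm
      refine sum_nbij' (fun m => m + (j : ℕ)) (fun m => m - (j : ℕ)) ?_ ?_ ?_ ?_ ?_
      · intro a ha; simp only [mem_Ioc] at *; omega
      · intro a ha; simp only [mem_Ioc] at *; omega
      · intro a ha; simp
      · intro a ha; simp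
      · intro a ha
        have : p i + ((j : ℕ) : ℤ) - (a + (j : ℕ)) = p i - a := by ring
        simp [this]
    rw [this]
    have key := (Matrix.detRowAlternating (n := Fin k) (R := R)).toMultilinearMap.map_sum_finset
      (fun (i : Fin k) (m : ℤ) => (x n ^ (p i - m).toNat) • (fun j : Fin k => HZ x n (m + (j : ℕ))))
      (fun i => Ioc (p (i + 1)) (p i))
    refine Eq.trans key ?_
    refine sum_congr rfl fun m _ => ?_
    have k2 := (Matrix.detRowAlternating (n := Fin k) (R := R)).toMultilinearMap.map_smul_univ
      (fun i : Fin k => x n ^ (p i - m i).toNat) (fun i => (fun j : Fin k => HZ x n (m i + (j : ℕ))))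
    refine Eq.trans k2 ?_
    rw [smul_eq_mul]; rfl
  · ext j
    simp only [Pi.zero_apply]
    apply HZ_neg
    rw [hk]; have := j.2; omega

end Hrec
end FFLP

namespace FFLP
open Finset

section Hsym
variable {R : Type*} [CommRing R]

lemma hsum_option {α : Type*} [Fintype α] [DecidableEq α] (f : Option α → R) (m : ℕ) :
    ∑ s : Sym (Option α) (m + 1), (s.1.map f).prod
      = f none * ∑ s : Sym (Option α) m, (s.1.map f).prod
        + ∑ s : Sym α (m + 1), (s.1.map (fun a => f (some a))).prod := by
  have e := Equiv.sum_comp (symOptionSuccEquiv (α := α) (n := m)).symm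
    (fun s : Sym (Option α) (m + 1) => ((s : Multiset (Option α)).map f).prod)
  refine e.symm.trans ?_
  rw [Fintype.sum_sum_type, mul_sum]
  congr 1
  · refine sum_congr rfl fun s _ => ?_
    simp only [symOptionSuccEquiv, Equiv.coe_fn_symm_mk, SymOptionSuccEquiv.decode_inl]
    have : ((none ::ₛ s : Sym (Option α) (m + 1)) : Multiset (Option α)) = none ::ₘ (s : Multiset (Option α)) := rfl
    rw [this, Multiset.map_cons, Multiset.prod_cons]
    rfl
  · refine sum_congr rfl fun s _ => ?_
    simp [symOptionSuccEquiv, Multiset.map_map, Function.comp_def]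

lemma HN_eq (x : ℕ → R) (n : ℕ) : ∀ m : ℕ,
    ∑ s : Sym (Fin n) m, (s.1.map (fun i : Fin n => x i)).prod = HN x n m := by
  induction n with
  | zero =>
    intro m
    cases m with
    | zero => simp [HN, Sym.eq_nil_of_card_zero]
    | succ m => simp [HN]
  | succ n ih =>
    intro m
    induction m with
    | zero => simp [HN, Sym.eq_nil_of_card_zero]
    | succ m ihm =>
      rw [HN, ← ihm, ← ih]
      have tr : ∀ m, ∑ s : Sym (Fin (n + 1)) m, (s.1.map (fun i : Fin (n + 1) => x i)).prod
          = ∑ s : Sym (Option (Fin n)) m,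
            (s.1.map (fun o : Option (Fin n) => x (finSuccEquivLast.symm o))).prod := by
        intro m
        rw [← (Sym.equivCongr (n := m) (finSuccEquivLast (n := n))).symm.sum_comp]
        refine sum_congr rfl fun s _ => ?_
        simp [Sym.equivCongr, Multiset.map_map, Function.comp_def]
      rw [tr, hsum_option, ← tr]
      simp
end Hsym

/-- variables of the polynomial ring indexed by naturals -/
noncomputable def xv (N : ℕ) (i : ℕ) : MvPolynomial (Fin N) ℤ :=
  if h : i < N then MvPolynomial.X ⟨i, h⟩ else 0

lemma xv_fin (N : ℕ) (i : Fin N) : xv N i = MvPolynomial.X i := by simp [xv]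

lemma homog_eq (N : ℕ) (m : ℤ) : homog N m = HZ (xv N) N m := by
  unfold homog HZ
  split_ifs
  · rw [← HN_eq, MvPolynomial.hsymm]
    refine sum_congr rfl fun s _ => ?_
    simp [xv_fin]
  · rfl

lemma skewSchur_eq (N k : ℕ) (lam : ℕ → ℕ) :
    skewSchur N k lam (fun _ => 0) = JT (xv N) N k (fun i => (lam i : ℤ) - i) := by
  unfold skewSchur JT
  congr 1
  refine Matrix.ext fun i j => ?_
  simp [homog_eq]

lemma skewSchur_symm (N k : ℕ) (lam : ℕ → ℕ) :
    (skewSchur N k lam (fun _ => 0)).IsSymmetric := by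
  intro e
  unfold skewSchur
  have := RingHom.map_det (MvPolynomial.rename (R := ℤ) e).toRingHom
    (Matrix.of fun i j : Fin k =>
    homog N ((lam i : ℤ) - ((fun _ => 0 : ℕ → ℕ) j : ℤ) - (i : ℤ) + (j : ℤ)))
  refine Eq.trans this ?_
  congr 1
  refine Matrix.ext fun i j => ?_
  simp only [RingHom.mapMatrix_apply, Matrix.map_apply, Matrix.of_apply]
  unfold homog
  split_ifs
  · exact MvPolynomial.hsymm_isSymmetric _ _ _ e
  · simp

section Bialt
variable {R : Type*} [CommRing R]

lemma conv_step (x : ℕ → R) (n K : ℕ) (c : ℕ → R) (hc : ∀ j, K ≤ j → c j = 0) (g : ℤ → R)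
    (hg : ∀ m, ∑ j ∈ range K, c j * HZ x n (m - j) = g m) :
    ∃ c' : ℕ → R, (∀ j, K + 1 ≤ j → c' j = 0) ∧
      ∀ m : ℤ, ∑ j ∈ range (K + 1), c' j * HZ x (n + 1) (m - j) = g m := by
  refine ⟨fun j => c j - (if j = 0 then 0 else x n * c (j - 1)), ?_, ?_⟩
  · intro j hj
    simp only
    rw [hc j (by omega), hc (j - 1) (by omega)]; simp
  · intro m
    rw [← hg m]
    simp only [sub_mul, sum_sub_distrib]
    rw [sum_range_succ, hc K le_rfl, sum_range_succ' (fun j => (if j = 0 then 0 else x n * c (j - 1)) *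
      HZ x (n + 1) (m - (j : ℕ)))]
    simp only [zero_mul, add_zero, if_true, Nat.add_sub_cancel]
    rw [← sum_sub_distrib]
    refine sum_congr rfl fun j _ => ?_
    have : m - ((j + 1 : ℕ) : ℤ) = m - j - 1 := by push_cast; ring
    rw [if_neg (by omega), HZ_succ x n (m - j), this]; ring

lemma exists_inv (x : ℕ → R) (n : ℕ) : ∃ d : ℕ → R, (∀ j, n + 1 ≤ j → d j = 0) ∧
    ∀ m : ℤ, ∑ j ∈ range (n + 1), d j * HZ x n (m - j) = if m = 0 then 1 else 0 := by
  induction n with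
  | zero =>
    refine ⟨fun j => if j = 0 then 1 else 0, ?_, ?_⟩
    · intro j hj; simp; omega
    · intro m; simp [HZ_zero_left]
  | succ n ih =>
    obtain ⟨d, h1, h2⟩ := ih
    exact conv_step x n (n + 1) d h1 _ h2

lemma exists_coef (x : ℕ → R) (n : ℕ) (l : ℕ) (hl : l < n) : ∃ c : ℕ → R, (∀ j, n ≤ j → c j = 0) ∧
    ∀ m : ℤ, ∑ j ∈ range n, c j * HZ x n (m - j) = if 0 ≤ m then x l ^ m.toNat else 0 := by
  induction n with
  | zero => omega
  | succ n ih =>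
    by_cases h : l < n
    · obtain ⟨c, h1, h2⟩ := ih h
      exact conv_step x n n c h1 _ h2
    · have : l = n := by omega
      subst this
      obtain ⟨d, h1, h2⟩ := exists_inv x l
      refine ⟨d, h1, ?_⟩
      have neg : ∀ m : ℤ, m < 0 → ∑ j ∈ range (l + 1), d j * HZ x (l + 1) (m - j) = 0 := by
        intro m hm
        refine sum_eq_zero fun j _ => ?_
        rw [HZ_neg _ _ _ (by omega)]; simp
      have step : ∀ m : ℤ, ∑ j ∈ range (l + 1), d j * HZ x (l + 1) (m - j)
          = x l * ∑ j ∈ range (l + 1), d j * HZ x (l + 1) (m - 1 - j) + if m = 0 then 1 else 0 := by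
        intro m
        rw [← h2 m, mul_sum, ← sum_add_distrib]
        refine sum_congr rfl fun j _ => ?_
        rw [HZ_succ x l (m - j)]
        have : m - (j : ℤ) - 1 = m - 1 - j := by ring
        rw [this]; ring
      have nn : ∀ m : ℕ, ∑ j ∈ range (l + 1), d j * HZ x (l + 1) ((m : ℤ) - j) = x l ^ m := by
        intro m
        induction m with
        | zero => rw [step, neg _ (by norm_num)]; simp
        | succ m ihm =>
          rw [step]
          have : ((m + 1 : ℕ) : ℤ) - 1 = m := by push_cast; ring
          rw [this, ihm, if_neg (by push_cast; omega)]
          ring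
      intro m
      split_ifs with hm
      · have := nn m.toNat
        rwa [Int.toNat_of_nonneg hm] at this
      · exact neg m (by omega)

/-- alternants -/
noncomputable def alt (x : ℕ → R) (N : ℕ) (α : ℕ → ℕ) : R :=
  Matrix.det (Matrix.of fun i l : Fin N => x l ^ α i)

lemma alt_eq_JT (x : ℕ → R) (N : ℕ) (nu : ℕ → ℕ) :
    alt x N (fun i => nu i + (N - 1 - i)) = JT x N N (fun i => (nu i : ℤ) - i) * alt x N (fun i => N - 1 - i) := by
  choose c hc0 hc using fun l : Fin N => exists_coef x N l l.2
  let E : Matrix (Fin N) (Fin N) R := Matrix.of fun j l => c l (N - 1 - j)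
  have main : ∀ nu : ℕ → ℕ, alt x N (fun i => nu i + (N - 1 - i))
      = JT x N N (fun i => (nu i : ℤ) - i) * E.det := by
    intro nu
    unfold alt JT
    rw [← Matrix.det_mul]
    congr 1
    ext i l
    rw [Matrix.mul_apply]
    simp only [Matrix.of_apply, E]
    have := hc l ((nu i + (N - 1 - i) : ℕ) : ℤ)
    rw [if_pos (by omega), Int.toNat_natCast] at this
    rw [← this]
    rw [← Fin.sum_univ_eq_sum_range (fun j => c l j * HZ x N (((nu i + (N - 1 - i) : ℕ) : ℤ) - (j : ℕ))) N]
    rw [← Equiv.sum_comp Fin.revPerm]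
    refine sum_congr rfl fun j _ => ?_
    rw [mul_comm]
    have hi := i.2
    have hj := j.2
    have e1 : ((Fin.revPerm j : Fin N) : ℕ) = N - 1 - j := by
      simp [Fin.revPerm]; omega
    rw [e1]
    congr 2
    omega
  rw [main nu]
  congr 1
  have h0 := main (fun _ => 0)
  simp only [zero_add] at h0
  rw [h0]
  have : JT x N N (fun i => ((0 : ℕ) : ℤ) - i) = 1 := by
    unfold JT
    rw [Matrix.det_of_isUpperTriangular]
    · simp [HZ_zero]
    · intro i j hij
      simp only [Matrix.of_apply]
      apply HZ_neg
      have : (j : ℕ) < i := hij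
      omega
  rw [this, one_mul]

lemma alt_swap (x : ℕ → R) (N : ℕ) (α β : ℕ → ℕ) (i j : Fin N) (hij : i ≠ j)
    (h1 : β i = α j) (h2 : β j = α i) (h3 : ∀ l : Fin N, l ≠ i → l ≠ j → β l = α l) :
    alt x N β = - alt x N α := by
  unfold alt
  have := Matrix.det_permute (Equiv.swap i j) (Matrix.of fun i l : Fin N => x l ^ α i)
  rw [Equiv.Perm.sign_swap hij] at this
  simp only [Units.val_neg, Units.val_one, Int.cast_neg, Int.cast_one, neg_mul, one_mul] at this
  rw [← this]
  congr 1
  ext a l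
  simp only [Matrix.of_apply, Matrix.submatrix_apply, id]
  congr 1
  by_cases ha : a = i
  · subst ha; simp [h1]
  · by_cases hb : a = j
    · subst hb; simp [h2]
    · rw [Equiv.swap_apply_of_ne_of_ne ha hb, h3 a ha hb]

end Bialt

lemma alt_delta_ne (N : ℕ) : alt (xv N) N (fun i => N - 1 - i) ≠ 0 := by
  unfold alt
  have h := (Matrix.det_vandermonde_ne_zero_iff (v := fun l : Fin N => (MvPolynomial.X l : MvPolynomial (Fin N) ℤ))).2
    (MvPolynomial.X_injective)
  rw [← Matrix.det_transpose] at h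
  intro h0
  apply h
  have := Matrix.det_permute (Fin.revPerm (n := N)) (Matrix.of fun i l : Fin N => xv N l ^ (N - 1 - (i : ℕ)))
  rw [h0, mul_zero] at this
  rw [← this]
  congr 1
  refine Matrix.ext fun i l => ?_
  simp only [Matrix.of_apply, Matrix.submatrix_apply, id, Matrix.transpose_apply, Matrix.vandermonde_apply, xv_fin]
  congr 1
  have := i.2
  simp [Fin.revPerm]; omega

/-- A symmetric sum of monomials times the Vandermonde alternant is the sum of alternants. -/
lemma symm_mul_alt {ι : Type*} (N : ℕ) (S : Finset ι) (wt : ι → ℕ → ℕ)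
    (hF : (∑ o ∈ S, ∏ i ∈ range N, xv N i ^ wt o i).IsSymmetric) :
    (∑ o ∈ S, ∏ i ∈ range N, xv N i ^ wt o i) * alt (xv N) N (fun i => N - 1 - i)
      = ∑ o ∈ S, alt (xv N) N (fun i => wt o i + (N - 1 - i)) := by
  have expand : ∀ α : ℕ → ℕ, alt (xv N) N α
      = ∑ s : Equiv.Perm (Fin N), (Equiv.Perm.sign s : ℤ) •
        MvPolynomial.rename s (∏ i : Fin N, xv N i ^ α i) := by
    intro α
    unfold alt
    rw [← Matrix.det_transpose, Matrix.det_apply]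
    refine sum_congr rfl fun s _ => ?_
    rw [Units.smul_def, map_prod]
    congr 1
    refine prod_congr rfl fun i _ => ?_
    simp [xv_fin]
  rw [expand, mul_sum]
  simp_rw [expand]
  rw [sum_comm]
  refine sum_congr rfl fun s _ => ?_
  rw [mul_smul_comm, ← smul_sum]
  congr 1
  conv_lhs => rw [← hF s, ← map_mul]
  rw [← map_sum]
  congr 1
  rw [sum_mul]
  refine sum_congr rfl fun o _ => ?_
  rw [← Fin.prod_univ_eq_prod_range, ← prod_mul_distrib]
  refine prod_congr rfl fun i _ => ?_
  rw [pow_add]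

end FFLP

namespace FFLP
open Finset

/-- Local conditions for level functions. -/
structure Loc (N : ℕ → ℤ → ℤ) : Prop where
  a : ∀ h x, N h (x + 1) ≤ N h x
  b : ∀ h x, N h x ≤ N h (x + 1) + 1
  c : ∀ h x, N h x ≤ N (h + 1) x
  d : ∀ h x, N (h + 1) x ≤ N h (x + 1) + 1

structure IsObj (L : ℕ) (P0 P1 : ℤ → ℤ) (N : ℕ → ℤ → ℤ) : Prop where
  loc : Loc N
  bot : N 0 = P0
  top : ∀ h, L ≤ h → N h = P1

def AgreeOff (W : ℤ) (P0 P1 : ℤ → ℤ) : Prop := ∀ x, (x < -W ∨ W ≤ x) → P0 x = P1 x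

lemma Loc.mono {N : ℕ → ℤ → ℤ} (h : Loc N) (x : ℤ) : Monotone (fun l => N l x) :=
  monotone_nat_of_le_succ fun l => h.c l x

lemma Loc.anti {N : ℕ → ℤ → ℤ} (h : Loc N) (l : ℕ) : Antitone (N l) := by
  have : ∀ x : ℤ, ∀ n : ℕ, N l (x + n) ≤ N l x := by
    intro x n
    induction n with
    | zero => simp
    | succ n ih => push_cast; have := h.a l (x + n); rw [add_assoc] at this; omega
  intro x y hxy
  have := this x (y - x).toNat
  rwa [show x + ((y - x).toNat : ℤ) = y by omega] at this

lemma IsObj.ge {L : ℕ} {P0 P1 : ℤ → ℤ} {N : ℕ → ℤ → ℤ} (h : IsObj L P0 P1 N) (l : ℕ) (x : ℤ) :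
    P0 x ≤ N l x := by
  have := h.loc.mono x (Nat.zero_le l)
  simpa [h.bot] using this

lemma IsObj.le {L : ℕ} {P0 P1 : ℤ → ℤ} {N : ℕ → ℤ → ℤ} (h : IsObj L P0 P1 N) (l : ℕ) (x : ℤ) :
    N l x ≤ P1 x := by
  have h1 := h.loc.mono x (le_max_left l L)
  have h2 := h.top (max l L) (le_max_right l L)
  simpa [h2] using h1

lemma IsObj.off {L : ℕ} {P0 P1 : ℤ → ℤ} {N : ℕ → ℤ → ℤ} (h : IsObj L P0 P1 N) {W : ℤ}
    (hW : AgreeOff W P0 P1) (l : ℕ) (x : ℤ) (hx : x < -W ∨ W ≤ x) : N l x = P0 x := by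
  have h1 := h.ge l x
  have h2 := h.le l x
  have := hW x hx
  omega

lemma finite_obj (L : ℕ) (P0 P1 : ℤ → ℤ) (W : ℤ) (hW : AgreeOff W P0 P1) :
    {N | IsObj L P0 P1 N}.Finite := by
  let f : (ℕ → ℤ → ℤ) → (Fin L × (Ico (-W) W : Finset ℤ)) → ℤ := fun N p => N p.1 p.2
  apply Set.Finite.of_finite_image (f := f)
  · apply Set.Finite.subset (s := Set.pi Set.univ
      (fun p : Fin L × (Ico (-W) W : Finset ℤ) => Set.Icc (P0 p.2) (P1 p.2)))
    · exact Set.Finite.pi fun p => Set.finite_Icc (P0 p.2) (P1 p.2)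
    · rintro g ⟨N, hN, rfl⟩ p _
      exact ⟨hN.ge _ _, hN.le _ _⟩
  · intro N hN M hM hf
    funext l x
    by_cases hl : L ≤ l
    · rw [hN.top l hl, hM.top l hl]
    · by_cases hx : x ∈ Ico (-W) W
      · exact congrFun hf (⟨l, by omega⟩, ⟨x, hx⟩)
      · rw [mem_Ico] at hx
        rw [hN.off hW l x (by omega), hM.off hW l x (by omega)]

open Classical in
/-- the finite set of objects -/
noncomputable def X (L : ℕ) (P0 P1 : ℤ → ℤ) : Finset (ℕ → ℤ → ℤ) :=
  if h : {N | IsObj L P0 P1 N}.Finite then h.toFinset else ∅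

lemma mem_X {L : ℕ} {P0 P1 : ℤ → ℤ} {W : ℤ} (hW : AgreeOff W P0 P1) (N : ℕ → ℤ → ℤ) :
    N ∈ X L P0 P1 ↔ IsObj L P0 P1 N := by
  unfold X
  rw [dif_pos (finite_obj L P0 P1 W hW)]
  simp

noncomputable def wt (W : ℤ) (N : ℕ → ℤ → ℤ) (h : ℕ) : ℤ := ∑ x ∈ Ico (-W) W, (N (h + 1) x - N h x)

lemma wt_nonneg {W : ℤ} {N : ℕ → ℤ → ℤ} (hN : Loc N) (h : ℕ) : 0 ≤ wt W N h :=
  sum_nonneg fun x _ => by have := hN.c h x; omega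

noncomputable def GF {R : Type*} [CommRing R] (x : ℕ → R) (W : ℤ) (L : ℕ) (P0 P1 : ℤ → ℤ) : R :=
  ∑ N ∈ X L P0 P1, ∏ h ∈ range L, x h ^ (wt W N h).toNat

/-- profile of a decreasing position vector -/
def prof (k : ℕ) (c e : ℤ) (p : ℕ → ℤ) (x : ℤ) : ℤ := e + #{r ∈ range k | x - c < p r}

structure SD (k : ℕ) (p : ℕ → ℤ) : Prop where
  lt : ∀ i, i < k → p (i + 1) < p i
  last : p k = - k

lemma SD.anti {k : ℕ} {p : ℕ → ℤ} (h : SD k p) (i d : ℕ) (hid : i + d ≤ k) : p (i + d) + d ≤ p i := by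
  induction d with
  | zero => simp
  | succ d ih =>
    have := ih (by omega)
    have h2 := h.lt (i + d) (by omega)
    rw [← add_assoc]; push_cast; omega

lemma SD.ge {k : ℕ} {p : ℕ → ℤ} (h : SD k p) (i : ℕ) (hi : i ≤ k) : -(i : ℤ) ≤ p i := by
  have := h.anti i (k - i) (by omega)
  rw [show i + (k - i) = k by omega, h.last] at this
  push_cast [Nat.cast_sub hi] at this
  omega

lemma prof_ge (k : ℕ) (c e : ℤ) (p : ℕ → ℤ) (x : ℤ) : e ≤ prof k c e p x := by unfold prof; omega

lemma prof_le (k : ℕ) (c e : ℤ) (p : ℕ → ℤ) (x : ℤ) : prof k c e p x ≤ e + k := by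
  unfold prof
  have := card_filter_le (range k) (fun r => x - c < p r)
  rw [card_range] at this
  omega

lemma prof_le_iff {k : ℕ} {p : ℕ → ℤ} (h : SD k p) (c e x : ℤ) (r : ℕ) (hr : r < k) :
    prof k c e p x ≤ e + r ↔ p r ≤ x - c := by
  constructor
  · intro hle
    by_contra hlt
    push Not at hlt
    have : range (r + 1) ⊆ {r ∈ range k | x - c < p r} := by
      intro s hs
      simp only [mem_range, mem_filter] at hs ⊢
      refine ⟨by omega, ?_⟩
      have := h.anti s (r - s) (by omega)
      rw [show s + (r - s) = r by omega] at this
      omega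
    have := card_le_card this
    unfold prof at hle
    rw [card_range] at this
    omega
  · intro hle
    have : {r ∈ range k | x - c < p r} ⊆ range r := by
      intro s hs
      simp only [mem_range, mem_filter] at hs ⊢
      by_contra hsr
      have := h.anti r (s - r) (by omega)
      rw [show r + (s - r) = s by omega] at this
      omega
    have := card_le_card this
    unfold prof
    rw [card_range] at this
    omega

/-- characterization of profile by the inequalities -/
lemma eq_of_iff {k : ℕ} {e a b : ℤ} (ha : e ≤ a) (ha' : a ≤ e + k) (hb : e ≤ b) (hb' : b ≤ e + k)
    (h : ∀ r : ℕ, r < k → (a ≤ e + r ↔ b ≤ e + r)) : a = b := by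
  by_contra hne
  rcases lt_or_gt_of_ne hne with hlt | hlt
  · have := h (a - e).toNat (by omega); omega
  · have := h (b - e).toNat (by omega); omega

lemma SD_zero (k : ℕ) : SD k (fun i => -(i : ℤ)) := ⟨fun i _ => by push_cast; omega, rfl⟩

/-- extend a vector of positions -/
def ext (k : ℕ) (m : Fin k → ℤ) (r : ℕ) : ℤ := if h : r < k then m ⟨r, h⟩ else -r

lemma ext_fin (k : ℕ) (m : Fin k → ℤ) (r : Fin k) : ext k m r = m r := by simp [ext]

noncomputable abbrev box (k : ℕ) (p : ℕ → ℤ) : Finset (Fin k → ℤ) :=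
  Fintype.piFinset (fun i : Fin k => Ioc (p (i + 1)) (p i))

lemma box_lt {k : ℕ} {p : ℕ → ℤ} {m : Fin k → ℤ} (hm : m ∈ box k p) (r : ℕ)
    (hr : r < k) : p (r + 1) < ext k m r ∧ ext k m r ≤ p r := by
  rw [Fintype.mem_piFinset] at hm
  have := hm ⟨r, hr⟩
  simpa [ext, hr] using this

lemma box_SD {k : ℕ} {p : ℕ → ℤ} (hp : SD k p) {m : Fin k → ℤ} (hm : m ∈ box k p) : SD k (ext k m) := by
  refine ⟨fun i hi => ?_, by simp [ext]⟩
  have h1 := box_lt hm i hi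
  by_cases h : i + 1 < k
  · have := box_lt hm (i + 1) h; omega
  · have : i + 1 = k := by omega
    have h2 := hp.last
    rw [← this] at h2
    have h3 : ext k m (i + 1) = -((i + 1 : ℕ) : ℤ) := by unfold ext; rw [dif_neg h]
    omega

lemma prof_step {k : ℕ} {p : ℕ → ℤ} (h : SD k p) (c e x : ℤ) :
    prof k c e p (x + 1) ≤ prof k c e p x ∧ prof k c e p x ≤ prof k c e p (x + 1) + 1 := by
  have g1 := prof_ge k c e p x
  have g2 := prof_le k c e p x
  have g3 := prof_ge k c e p (x + 1)
  have g4 := prof_le k c e p (x + 1)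
  constructor
  · by_contra hlt
    have i1 := prof_le_iff h c e x (prof k c e p x - e).toNat (by omega)
    have i2 := prof_le_iff h c e (x + 1) (prof k c e p x - e).toNat (by omega)
    omega
  · by_contra hlt
    have i1 := prof_le_iff h c e (x + 1) (prof k c e p (x + 1) - e).toNat (by omega)
    have i2 := prof_le_iff h c e x ((prof k c e p (x + 1) - e).toNat + 1) (by omega)
    have i3 := h.lt (prof k c e p (x + 1) - e).toNat (by omega)
    omega

lemma prof_comp {k : ℕ} {p : ℕ → ℤ} (hp : SD k p) {m : Fin k → ℤ} (hm : m ∈ box k p) (c e x : ℤ) :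
    prof k c e (ext k m) x ≤ prof k c e p x ∧ prof k c e p x ≤ prof k c e (ext k m) (x + 1) + 1 := by
  have hs := box_SD hp hm
  have g1 := prof_ge k c e p x
  have g2 := prof_le k c e p x
  have g3 := prof_ge k c e (ext k m) (x + 1)
  have g4 := prof_le k c e (ext k m) (x + 1)
  have g5 := prof_ge k c e (ext k m) x
  have g6 := prof_le k c e (ext k m) x
  constructor
  · by_contra hlt
    have i1 := prof_le_iff hp c e x (prof k c e p x - e).toNat (by omega)
    have i2 := prof_le_iff hs c e x (prof k c e p x - e).toNat (by omega)
    have := box_lt hm (prof k c e p x - e).toNat (by omega)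
    omega
  · by_contra hlt
    have i1 := prof_le_iff hs c e (x + 1) (prof k c e (ext k m) (x + 1) - e).toNat (by omega)
    have i2 := prof_le_iff hp c e x ((prof k c e (ext k m) (x + 1) - e).toNat + 1) (by omega)
    have := box_lt hm (prof k c e (ext k m) (x + 1) - e).toNat (by omega)
    omega

lemma prof_surj {k : ℕ} {p : ℕ → ℤ} (hp : SD k p) (c e : ℤ) (n : ℤ → ℤ)
    (h1 : Antitone n) (h2 : ∀ x, n x ≤ prof k c e p x) (h3 : ∀ x, prof k c e p x ≤ n (x + 1) + 1)
    (h4 : ∀ x, prof k c e (fun i => -(i : ℤ)) x ≤ n x) :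
    ∃ m ∈ box k p, n = prof k c e (ext k m) := by
  have up : ∀ r : ℕ, r < k → n (p r + c) ≤ e + r := fun r hr =>
    (h2 _).trans ((prof_le_iff hp c e _ r hr).2 (by omega))
  have low : ∀ r : ℕ, r < k → ∀ x, n x ≤ e + r → p (r + 1) + c < x := by
    intro r hr x hx
    by_contra hlt
    by_cases hrk : r + 1 < k
    · have i1 := prof_le_iff hp c e (x - 1) (r + 1) hrk
      have := h3 (x - 1)
      rw [sub_add_cancel] at this
      push_cast at i1
      have : prof k c e p (x - 1) ≤ e + (r + 1) := by omega
      have := i1.1 this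
      omega
    · have hk : r + 1 = k := by omega
      have i1 := prof_le_iff (SD_zero k) c e x r hr
      have := h4 x
      have := i1.1 (by omega)
      have hl := hp.last
      rw [← hk] at hl
      push_cast at hl
      omega
  have least : ∀ r : Fin k, ∃ z : ℤ, n (z + c) ≤ e + (r : ℕ) ∧ ∀ y, n (y + c) ≤ e + (r : ℕ) → z ≤ y := by
    intro r
    exact Int.exists_least_of_bdd ⟨p (r + 1), fun z hz => by
      have := low r r.2 _ hz; omega⟩ ⟨p r, up r r.2⟩
  choose m hm1 hm2 using least
  have hbox : m ∈ box k p := by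
    rw [Fintype.mem_piFinset]
    intro r
    rw [mem_Ioc]
    have a1 := low r r.2 _ (hm1 r)
    have a2 := hm2 r _ (up r r.2)
    exact ⟨by omega, a2⟩
  refine ⟨m, hbox, ?_⟩
  funext x
  have q1 := h4 x
  have q2 := prof_ge k c e (fun i => -(i : ℤ)) x
  have q3 := h2 x
  have q4 := prof_le k c e p x
  apply eq_of_iff (k := k) (e := e) (by omega) (by omega) (prof_ge _ _ _ _ _) (prof_le _ _ _ _ _)
  intro r hr
  rw [prof_le_iff (box_SD hp hbox) c e x r hr, show ext k m r = m ⟨r, hr⟩ by simp [ext, hr]]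
  constructor
  · intro h
    apply hm2 ⟨r, hr⟩
    simpa using h
  · intro h
    have := h1 (show m ⟨r, hr⟩ + c ≤ x by omega)
    have := hm1 ⟨r, hr⟩
    simp only at this
    omega

lemma prof_inj {k : ℕ} {p q : ℕ → ℤ} (hp : SD k p) (hq : SD k q) (c e : ℤ)
    (h : prof k c e p = prof k c e q) (r : ℕ) (hr : r < k) : p r = q r := by
  have a1 := prof_le_iff hp c e (p r + c) r hr
  have a2 := prof_le_iff hp c e (q r + c) r hr
  have b1 := prof_le_iff hq c e (p r + c) r hr
  have b2 := prof_le_iff hq c e (q r + c) r hr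
  rw [← h] at b1 b2
  omega

lemma prof_sum {k : ℕ} {p : ℕ → ℤ} (hp : SD k p) (c e W : ℤ) (h1 : -W ≤ -k + c)
    (h2 : ∀ r, r < k → p r + c ≤ W) :
    ∑ x ∈ Ico (-W) W, prof k c e p x = ∑ _x ∈ Ico (-W) W, e + ∑ r ∈ range k, (p r + c + W) := by
  unfold prof
  rw [sum_add_distrib]
  congr 1
  simp_rw [card_filter]
  push_cast
  rw [sum_comm]
  refine sum_congr rfl fun r hr => ?_
  rw [mem_range] at hr
  have hge := hp.ge r hr.le
  have := h2 r hr
  rw [← sum_filter]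
  have : {a ∈ Ico (-W) W | a - c < p r} = Ico (-W) (p r + c) := by
    ext a; simp only [mem_filter, mem_Ico]; omega
  rw [this, sum_const, Int.card_Ico]
  simp
  omega

lemma agree {k : ℕ} {p : ℕ → ℤ} (hp : SD k p) (c e W : ℤ) (h1 : -W ≤ -k + c)
    (h2 : ∀ r, r < k → p r + c ≤ W) : AgreeOff W (prof k c e (fun i => -(i : ℤ))) (prof k c e p) := by
  intro x hx
  apply eq_of_iff (k := k) (e := e) (prof_ge _ _ _ _ _) (prof_le _ _ _ _ _) (prof_ge _ _ _ _ _) (prof_le _ _ _ _ _)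
  intro r hr
  rw [prof_le_iff hp c e x r hr, prof_le_iff (SD_zero k) c e x r hr]
  have := h2 r hr
  have := hp.ge r hr.le
  have h3 := hp.anti r (k - r) (by omega)
  rw [show r + (k - r) = k by omega, hp.last] at h3
  omega
end FFLP

namespace FFLP
open Finset

lemma JT_zero {R : Type*} [CommRing R] (x : ℕ → R) (k : ℕ) (p : ℕ → ℤ) (hp : SD k p)
    (h : ∀ r, r < k → p r = -(r : ℤ)) : JT x 0 k p = 1 := by
  unfold JT
  have : (Matrix.of fun i j : Fin k => HZ x 0 (p i + (j : ℕ))) = 1 := by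
    refine Matrix.ext fun i j => ?_
    rw [Matrix.of_apply, HZ_zero_left, h i i.2, Matrix.one_apply]
    by_cases hij : i = j
    · subst hij; simp
    · rw [if_neg hij, if_neg]
      intro h; apply hij; ext; omega
  rw [this, Matrix.det_one]

lemma JT_zero' {R : Type*} [CommRing R] (x : ℕ → R) (k : ℕ) (p : ℕ → ℤ) (hp : SD k p)
    (h : ¬ ∀ r, r < k → p r = -(r : ℤ)) : JT x 0 k p = 0 := by
  push Not at h
  obtain ⟨r, hr, hne⟩ := h
  have h1 := hp.ge r hr.le
  have h2 := hp.anti 0 r (by omega)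
  rw [zero_add] at h2
  unfold JT
  apply Matrix.det_eq_zero_of_row_eq_zero (⟨0, by omega⟩ : Fin k)
  intro j
  rw [Matrix.of_apply, HZ_zero_left, if_neg]
  simp only
  omega

def extendTop (L : ℕ) (P1 : ℤ → ℤ) (N : ℕ → ℤ → ℤ) : ℕ → ℤ → ℤ :=
  fun h => if h ≤ L then N h else P1

lemma extendTop_obj {L : ℕ} {P0 P1 n : ℤ → ℤ} {N : ℕ → ℤ → ℤ} (hN : IsObj L P0 n N)
    (ha : ∀ x, P1 (x + 1) ≤ P1 x) (hb : ∀ x, P1 x ≤ P1 (x + 1) + 1)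
    (hc : ∀ x, n x ≤ P1 x) (hd : ∀ x, P1 x ≤ n (x + 1) + 1) :
    IsObj (L + 1) P0 P1 (extendTop L P1 N) := by
  have ht := hN.top L le_rfl
  refine ⟨⟨?_, ?_, ?_, ?_⟩, ?_, ?_⟩
  · intro h x; unfold extendTop; split_ifs
    · exact hN.loc.a h x
    · exact ha x
  · intro h x; unfold extendTop; split_ifs
    · exact hN.loc.b h x
    · exact hb x
  · intro h x; unfold extendTop; split_ifs with h1 h2 h2
    · exact hN.loc.c h x
    · have : h = L := by omega
      rw [this, ht]; exact hc x
    · omega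
    · exact le_rfl
  · intro h x; unfold extendTop; split_ifs with h1 h2 h2
    · exact hN.loc.d h x
    · omega
    · have : h = L := by omega
      rw [this, ht]; exact hd x
    · exact hb x
  · unfold extendTop; simp [hN.bot]
  · intro h hh; unfold extendTop; rw [if_neg (by omega)]

lemma trunc_obj {L : ℕ} {P0 P1 : ℤ → ℤ} {N : ℕ → ℤ → ℤ} (hN : IsObj (L + 1) P0 P1 N) :
    IsObj L P0 (N L) (extendTop L (N L) N) := by
  refine ⟨⟨?_, ?_, ?_, ?_⟩, ?_, ?_⟩
  · intro h x; unfold extendTop; split_ifs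
    · exact hN.loc.a h x
    · exact hN.loc.a L x
  · intro h x; unfold extendTop; split_ifs
    · exact hN.loc.b h x
    · exact hN.loc.b L x
  · intro h x; unfold extendTop; split_ifs with h1 h2 h2
    · exact hN.loc.c h x
    · have : h = L := by omega
      rw [this]
    · omega
    · exact le_rfl
  · intro h x; unfold extendTop; split_ifs with h1 h2 h2
    · exact hN.loc.d h x
    · omega
    · have : h = L := by omega
      rw [this]; exact hN.loc.b L x
    · exact hN.loc.b L x
  · unfold extendTop; simp [hN.bot]
  · intro h hh; unfold extendTop; split_ifs
    · rw [show h = L by omega]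
    · rfl

lemma wt_congr {W : ℤ} {N M : ℕ → ℤ → ℤ} {h : ℕ} (h1 : N h = M h) (h2 : N (h + 1) = M (h + 1)) :
    wt W N h = wt W M h := by unfold wt; rw [h1, h2]

theorem GF_eq_JT {R : Type*} [CommRing R] (x : ℕ → R) (k : ℕ) (c e W : ℤ) (hk : -W ≤ -k + c) (L : ℕ) :
    ∀ p : ℕ → ℤ, SD k p → (∀ r, r < k → p r + c ≤ W) →
    GF x W L (prof k c e (fun i => -(i : ℤ))) (prof k c e p) = JT x L k p := by
  classical
  set P0 := prof k c e (fun i => -(i : ℤ)) with hP0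
  induction L with
  | zero =>
    intro p hp hW
    have ag := agree hp c e W hk hW
    rw [← hP0] at ag
    unfold GF
    by_cases hz : ∀ r, r < k → p r = -(r : ℤ)
    · rw [JT_zero x k p hp hz]
      have he : P0 = prof k c e p := by
        funext y
        rw [hP0]; unfold prof
        congr 2
        apply congrArg
        apply filter_congr
        intro r hr
        rw [hz r (mem_range.1 hr)]
      have : X 0 P0 (prof k c e p) = {fun _ => P0} := by
        ext N
        rw [mem_X ag, mem_singleton]
        constructor
        · intro h; funext l; rw [h.top l (Nat.zero_le _), ← he]
        · rintro rfl
          refine ⟨⟨?_, ?_, ?_, ?_⟩, rfl, fun _ _ => he⟩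
          · intro _ y; exact (prof_step (SD_zero k) c e y).1
          · intro _ y; exact (prof_step (SD_zero k) c e y).2
          · intro _ y; exact le_rfl
          · intro _ y; exact (prof_step (SD_zero k) c e y).2
      rw [this]; simp
    · rw [JT_zero' x k p hp hz]
      have : X 0 P0 (prof k c e p) = ∅ := by
        rw [eq_empty_iff_forall_notMem]
        intro N hN
        rw [mem_X ag] at hN
        apply hz
        have he : P0 = prof k c e p := by rw [← hN.bot, hN.top 0 le_rfl]
        intro r hr
        exact (prof_inj (SD_zero k) hp c e he r hr).symm
      rw [this]; simp
  | succ L ih =>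
    intro p hp hW
    have ag := agree hp c e W hk hW
    rw [← hP0] at ag
    rw [JT_branch x L k p hp.lt hp.last]
    have boxW : ∀ m ∈ box k p, ∀ r, r < k → ext k m r + c ≤ W := by
      intro m hm r hr
      have := box_lt hm r hr; have := hW r hr; omega
    unfold GF
    have maps : ∀ N ∈ X (L + 1) P0 (prof k c e p), N L ∈ (box k p).image (fun m => prof k c e (ext k m)) := by
      intro N hN
      rw [mem_X ag] at hN
      have ht := hN.top (L + 1) le_rfl
      obtain ⟨m, hm, he⟩ := prof_surj hp c e (N L) (hN.loc.anti L)
        (fun y => by rw [← ht]; exact hN.loc.c L y) (fun y => by rw [← ht]; exact hN.loc.d L y)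
        (fun y => hN.ge L y)
      exact mem_image.2 ⟨m, hm, he.symm⟩
    rw [← sum_fiberwise_of_maps_to maps, sum_image]
    · refine sum_congr rfl fun m hm => ?_
      have hs := box_SD hp hm
      have agm := agree hs c e W hk (boxW m hm)
      rw [← hP0] at agm
      have e1 : Matrix.det (Matrix.of fun i j : Fin k => HZ x L (m i + (j : ℕ))) = JT x L k (ext k m) := by
        unfold JT; simp [ext_fin]
      rw [e1, ← ih _ hs (boxW m hm), GF, mul_sum]
      refine sum_bij' (fun N _ => extendTop L (N L) N) (fun N _ => extendTop L (prof k c e p) N)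
        ?_ ?_ ?_ ?_ ?_
      · intro N hN
        rw [mem_filter, mem_X ag] at hN
        rw [mem_X agm, ← hN.2]
        exact trunc_obj hN.1
      · intro N hN
        rw [mem_X agm] at hN
        rw [mem_filter, mem_X ag]
        refine ⟨extendTop_obj hN (fun y => (prof_step hp c e y).1) (fun y => (prof_step hp c e y).2)
          (fun y => (prof_comp hp hm c e y).1) (fun y => (prof_comp hp hm c e y).2), ?_⟩
        simp [extendTop, hN.top L le_rfl]
      · intro N hN
        rw [mem_filter, mem_X ag] at hN
        funext l
        unfold extendTop
        split_ifs with h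
        · rfl
        · rw [hN.1.top l (by omega)]
      · intro N hN
        rw [mem_X agm] at hN
        funext l
        unfold extendTop
        by_cases h : l ≤ L
        · simp [h]
        · simp [h, hN.top L le_rfl, hN.top l (by omega)]
      · intro N hN
        rw [mem_filter, mem_X ag] at hN
        rw [prod_range_succ, mul_comm]
        congr 1
        · rw [prod_pow_eq_pow_sum]
          congr 1
          have ht := hN.1.top (L + 1) le_rfl
          have : wt W N L = ∑ i : Fin k, (p i - m i) := by
            unfold wt
            rw [sum_sub_distrib, ht, hN.2, prof_sum hp c e W hk hW, prof_sum hs c e W hk (boxW m hm)]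
            rw [add_sub_add_left_eq_sub, ← sum_sub_distrib, ← Fin.sum_univ_eq_sum_range
              (fun r => p r + c + W - (ext k m r + c + W))]
            refine sum_congr rfl fun i _ => ?_
            rw [ext_fin]; ring
          rw [this]
          have : ∀ i : Fin k, (p i - m i) = (((p i - m i).toNat : ℕ) : ℤ) := by
            intro i
            have := box_lt hm i i.2
            rw [ext_fin] at this
            omega
          rw [sum_congr rfl fun i _ => this i, ← Nat.cast_sum, Int.toNat_natCast]
        · refine prod_congr rfl fun h hh => ?_
          rw [mem_range] at hh
          congr 2
          apply wt_congr
          · simp [extendTop, hh.le]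
          · simp [extendTop, Nat.succ_le_of_lt hh]
    · intro m hm m' hm' h
      funext r
      have := prof_inj (box_SD hp hm) (box_SD hp hm') c e h r r.2
      rwa [ext_fin, ext_fin] at this
end FFLP

namespace FFLP
open Finset

/-- free cells -/
def fr (N : ℕ → ℤ → ℤ) (j : ℕ) (x : ℤ) : Prop :=
  N j (x + 1) = N j x ∧ N (j + 2) (x - 1) = N (j + 2) x ∧ N (j + 2) x = N j x + 1

instance (N : ℕ → ℤ → ℤ) (j : ℕ) (x : ℤ) : Decidable (fr N j x) := by unfold fr; infer_instance

def ff (N : ℕ → ℤ → ℤ) (j : ℕ) (x : ℤ) : ℤ := if fr N j x then 2 * (N (j + 1) x - N j x) - 1 else 0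

def kap (N : ℕ → ℤ → ℤ) (j : ℕ) (x : ℤ) : ℤ := if N (j + 2) (x - 1) = N j x + 2 then 1 else 0

def cc (P Q : ℕ → ℤ → ℤ) (j : ℕ) (x : ℤ) : ℤ := ff P j x + ff Q j x

noncomputable def CC (W : ℤ) (P Q : ℕ → ℤ → ℤ) (j : ℕ) (x : ℤ) : ℤ := ∑ y ∈ Ico x W, cc P Q j y

def Win (W : ℤ) (N : ℕ → ℤ → ℤ) : Prop := ∀ h h' x, (x < -W ∨ W ≤ x) → N h x = N h' x

lemma IsObj.win {L : ℕ} {P0 P1 : ℤ → ℤ} {N : ℕ → ℤ → ℤ} (h : IsObj L P0 P1 N) {W : ℤ}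
    (hW : AgreeOff W P0 P1) : Win W N := by
  intro l l' x hx
  rw [h.off hW l x hx, h.off hW l' x hx]

lemma fr_win {W : ℤ} {N : ℕ → ℤ → ℤ} (hW : Win W N) {j : ℕ} {x : ℤ} (h : fr N j x) : -W ≤ x ∧ x < W := by
  by_contra hx
  have := hW j (j + 2) x (by omega)
  have := h.2.2
  omega

lemma ff_off {W : ℤ} {N : ℕ → ℤ → ℤ} (hW : Win W N) (j : ℕ) (x : ℤ) (hx : x < -W ∨ W ≤ x) : ff N j x = 0 := by
  unfold ff
  rw [if_neg]
  intro h
  have := fr_win hW h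
  omega

lemma CC_top {W : ℤ} (P Q : ℕ → ℤ → ℤ) (j : ℕ) (x : ℤ) (hx : W ≤ x) : CC W P Q j x = 0 := by
  unfold CC; rw [Ico_eq_empty (by omega)]; simp

lemma CC_rec {W : ℤ} {P Q : ℕ → ℤ → ℤ} (hP : Win W P) (hQ : Win W Q) (j : ℕ) (x : ℤ) :
    CC W P Q j x = cc P Q j x + CC W P Q j (x + 1) := by
  by_cases hx : W ≤ x
  · rw [CC_top _ _ _ _ hx, CC_top _ _ _ _ (by omega), cc, ff_off hP _ _ (Or.inr hx), ff_off hQ _ _ (Or.inr hx)]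
    simp
  · unfold CC
    have : Ico x W = insert x (Ico (x + 1) W) := by
      ext a; simp only [mem_insert, mem_Ico]; omega
    rw [this, sum_insert (by simp)]

lemma ff_cases {N : ℕ → ℤ → ℤ} (hN : Loc N) (j : ℕ) (x : ℤ) :
    (¬ fr N j x ∧ ff N j x = 0) ∨
    (fr N j x ∧ ff N j x = 1 ∧ N (j + 1) x = N j x + 1) ∨ (fr N j x ∧ ff N j x = -1 ∧ N (j + 1) x = N j x) := by
  unfold ff
  by_cases h : fr N j x
  · rw [if_pos h]
    have h1 := hN.c j x
    have h2 := hN.c (j + 1) x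
    have h3 := h.2.2
    rw [show j + 1 + 1 = j + 2 by ring] at h2
    by_cases h4 : N (j + 1) x = N j x
    · right; right; exact ⟨h, by omega, h4⟩
    · right; left; exact ⟨h, by omega, by omega⟩
  · left; rw [if_neg h]; exact ⟨h, rfl⟩

lemma ff_identity {N : ℕ → ℤ → ℤ} (hN : Loc N) (j : ℕ) (x : ℤ) :
    2 * N (j + 1) x - N j x - N (j + 2) x = ff N j x + kap N j x - kap N j (x + 1) := by
  have a0 := hN.a j x
  have b0 := hN.b j x
  have a2 := hN.a (j + 2) (x - 1)
  have b2 := hN.b (j + 2) (x - 1)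
  have c0 := hN.c j x
  have c1 := hN.c (j + 1) x
  have d0 := hN.d j x
  have d1 := hN.d (j + 1) (x - 1)
  rw [sub_add_cancel] at a2 b2 d1
  have e : j + 1 + 1 = j + 2 := rfl
  rw [e] at c1 d1
  unfold ff kap fr
  rw [add_sub_cancel_right]
  split_ifs <;> omega

lemma kap_off {W : ℤ} {N : ℕ → ℤ → ℤ} (hN : Loc N) (hW : Win W N) (j : ℕ) (x : ℤ) (hx : x ≤ -W ∨ W ≤ x) :
    kap N j x = 0 := by
  unfold kap
  rw [if_neg]
  intro h
  rcases hx with hx | hx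
  · have := hW (j + 2) j (x - 1) (by omega)
    have := hN.b j (x - 1)
    rw [sub_add_cancel] at this
    omega
  · have := hW (j + 2) j x (by omega)
    have := hN.b (j + 2) (x - 1)
    rw [sub_add_cancel] at this
    omega

lemma sum_telescope (g : ℤ → ℤ) (a b : ℤ) (h : a ≤ b) : ∑ x ∈ Ico a b, (g x - g (x + 1)) = g a - g b := by
  obtain ⟨n, rfl⟩ : ∃ n : ℕ, b = a + n := ⟨(b - a).toNat, by omega⟩
  clear h
  induction n with
  | zero => simp
  | succ n ih =>
    have : Ico a (a + ((n + 1 : ℕ) : ℤ)) = insert (a + n) (Ico a (a + (n : ℤ))) := by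
      ext y; simp only [mem_insert, mem_Ico]; push_cast; omega
    rw [this, sum_insert (by simp), ih]
    push_cast; rw [add_assoc a]; ring

lemma wt_diff {W : ℤ} (hW0 : 0 ≤ W) {N : ℕ → ℤ → ℤ} (hN : Loc N) (hW : Win W N) (j : ℕ) :
    wt W N j - wt W N (j + 1) = ∑ y ∈ Ico (-W) W, ff N j y := by
  unfold wt
  rw [← sum_sub_distrib]
  have : ∀ y, N (j + 1) y - N j y - (N (j + 1 + 1) y - N (j + 1) y)
      = ff N j y + (kap N j y - kap N j (y + 1)) := by
    intro y
    have := ff_identity hN j y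
    have e : j + 1 + 1 = j + 2 := rfl
    rw [e]; linarith
  rw [sum_congr rfl fun y _ => this y, sum_add_distrib, sum_telescope _ _ _ (by omega),
    kap_off hN hW j _ (Or.inl le_rfl), kap_off hN hW j _ (Or.inr le_rfl)]
  ring

/-! ### reflections -/

def lf (N : ℕ → ℤ → ℤ) (j : ℕ) (t y : ℤ) : Prop := y ≤ t ∧ fr N j y

instance (N : ℕ → ℤ → ℤ) (j : ℕ) (t x : ℤ) : Decidable (lf N j t x) := by unfold lf; infer_instance

def Irow (N : ℕ → ℤ → ℤ) (j : ℕ) (t r : ℤ) : Set ℤ := {y | lf N j t y ∧ N j y = r}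

open Classical in
noncomputable def sct (I : Set ℤ) : ℤ := if h : ∃ s, ∀ y ∈ I, s - y ∈ I then Classical.choose h else 0

noncomputable def rho (N : ℕ → ℤ → ℤ) (j : ℕ) (t y : ℤ) : ℤ := sct (Irow N j t (N j y)) - y

noncomputable def refl (N : ℕ → ℤ → ℤ) (j : ℕ) (t : ℤ) : ℕ → ℤ → ℤ :=
  Function.update N (j + 1) (fun y => if lf N j t y then 2 * N j y + 1 - N (j + 1) (rho N j t y) else N (j + 1) y)

lemma exists_sct (I : Set ℤ) (a b : ℤ) (hI : ∀ y ∈ I, a ≤ y ∧ y < b)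
    (hc : ∀ y ∈ I, ∀ z ∈ I, ∀ w, y ≤ w → w ≤ z → w ∈ I) : ∃ s, ∀ y ∈ I, s - y ∈ I := by
  by_cases hne : ∃ y, y ∈ I
  · obtain ⟨lo, h1, h2⟩ := Int.exists_least_of_bdd (P := fun y => y ∈ I) ⟨a, fun z hz => (hI z hz).1⟩ hne
    obtain ⟨hi, h3, h4⟩ := Int.exists_greatest_of_bdd (P := fun y => y ∈ I) ⟨b, fun z hz => (hI z hz).2.le⟩ hne
    refine ⟨lo + hi, fun y hy => hc lo h1 hi h3 _ ?_ ?_⟩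
    · have := h4 y hy; omega
    · have := h2 y hy; omega
  · exact ⟨0, fun y hy => (hne ⟨y, hy⟩).elim⟩

lemma Irow_convex {N : ℕ → ℤ → ℤ} (hN : Loc N) (j : ℕ) (t r : ℤ) :
    ∀ y ∈ Irow N j t r, ∀ z ∈ Irow N j t r, ∀ w, y ≤ w → w ≤ z → w ∈ Irow N j t r := by
  rintro y ⟨⟨hy1, hy2, hy3, hy4⟩, hy5⟩ z ⟨⟨hz1, hz2, hz3, hz4⟩, hz5⟩ w hyw hwz
  have a1 := hN.anti j hyw
  have a2 := hN.anti j hwz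
  have a3 := hN.anti (j + 2) hyw
  have a4 := hN.anti (j + 2) hwz
  rcases eq_or_lt_of_le hyw with rfl | h1
  · exact ⟨⟨hy1, hy2, hy3, hy4⟩, hy5⟩
  rcases eq_or_lt_of_le hwz with rfl | h2
  · exact ⟨⟨hz1, hz2, hz3, hz4⟩, hz5⟩
  have a5 := hN.anti j (show w + 1 ≤ z by omega)
  have a6 := hN.anti (j + 2) (show y ≤ w - 1 by omega)
  have a7 := hN.anti j (show w ≤ w + 1 by omega)
  have a8 := hN.anti (j + 2) (show w - 1 ≤ w by omega)
  refine ⟨⟨by omega, ?_, ?_, ?_⟩, ?_⟩ <;> omega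

lemma rho_spec {W : ℤ} {N : ℕ → ℤ → ℤ} (hN : Loc N) (hW : Win W N) {j : ℕ} {t y : ℤ} (h : lf N j t y) :
    lf N j t (rho N j t y) ∧ N j (rho N j t y) = N j y ∧ rho N j t (rho N j t y) = y := by
  have hex : ∃ s, ∀ z ∈ Irow N j t (N j y), s - z ∈ Irow N j t (N j y) :=
    exists_sct _ (-W) W (fun z hz => fr_win hW hz.1.2) (Irow_convex hN j t _)
  have hs := Classical.choose_spec hex
  have e : sct (Irow N j t (N j y)) = Classical.choose hex := by unfold sct; rw [dif_pos hex]
  have hy : y ∈ Irow N j t (N j y) := ⟨h, rfl⟩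
  have := hs y hy
  rw [← e] at this
  change rho N j t y ∈ _ at this
  refine ⟨this.1, this.2, ?_⟩
  rw [rho, this.2, rho]; ring

lemma rho_succ {N : ℕ → ℤ → ℤ} {j : ℕ} {t y : ℤ} (h : N j (y + 1) = N j y) :
    rho N j t y = rho N j t (y + 1) + 1 := by
  unfold rho; rw [h]; ring

lemma refl_ne (N : ℕ → ℤ → ℤ) (j : ℕ) (t : ℤ) (h : ℕ) (hh : h ≠ j + 1) : refl N j t h = N h := by
  unfold refl; rw [Function.update_of_ne hh]

lemma refl_eq (N : ℕ → ℤ → ℤ) (j : ℕ) (t : ℤ) (y : ℤ) : refl N j t (j + 1) y =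
    if lf N j t y then 2 * N j y + 1 - N (j + 1) (rho N j t y) else N (j + 1) y := by
  unfold refl; rw [Function.update_self]

lemma refl_gt (N : ℕ → ℤ → ℤ) (j : ℕ) (t : ℤ) (y : ℤ) (hy : t < y) : refl N j t (j + 1) y = N (j + 1) y := by
  rw [refl_eq, if_neg]; unfold lf; omega

lemma fr_refl (N : ℕ → ℤ → ℤ) (j : ℕ) (t : ℤ) (y : ℤ) : fr (refl N j t) j y ↔ fr N j y := by
  unfold fr; rw [refl_ne _ _ _ j (by omega), refl_ne _ _ _ (j + 2) (by omega)]

lemma lf_refl (N : ℕ → ℤ → ℤ) (j : ℕ) (t s : ℤ) (y : ℤ) : lf (refl N j t) j s y ↔ lf N j s y := by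
  unfold lf; rw [fr_refl]

lemma rho_refl (N : ℕ → ℤ → ℤ) (j : ℕ) (t s : ℤ) (y : ℤ) : rho (refl N j t) j s y = rho N j s y := by
  unfold rho Irow
  simp only [lf_refl, refl_ne N j t j (by omega : j ≠ j + 1)]

lemma refl_refl {W : ℤ} {N : ℕ → ℤ → ℤ} (hN : Loc N) (hW : Win W N) (j : ℕ) (t : ℤ) :
    refl (refl N j t) j t = N := by
  funext h y
  by_cases hh : h = j + 1
  · subst hh
    rw [refl_eq]
    simp only [lf_refl, rho_refl]
    split_ifs with hl
    · obtain ⟨h1, h2, h3⟩ := rho_spec hN hW hl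
      rw [refl_eq, if_pos h1, h3, refl_ne _ _ _ j (by omega), h2]; ring
    · rw [refl_eq, if_neg hl]
  · rw [refl_ne _ _ _ _ hh, refl_ne _ _ _ _ hh]

lemma fr_letter {N : ℕ → ℤ → ℤ} (hN : Loc N) {j : ℕ} {x : ℤ} (h : fr N j x) :
    N (j + 1) x = N j x ∨ N (j + 1) x = N j x + 1 := by
  have := ff_cases hN j x
  tauto

lemma next_of_not_fr {N : ℕ → ℤ → ℤ} (hN : Loc N) {j : ℕ} {x : ℤ} (h : fr N j x) (h' : ¬ fr N j (x + 1)) :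
    N (j + 1) (x + 1) = N j (x + 1) := by
  unfold fr at h h'
  rw [add_sub_cancel_right] at h'
  have a0 := hN.a j (x + 1)
  have b0 := hN.b j (x + 1)
  have a2 := hN.a (j + 2) x
  have b2 := hN.b (j + 2) x
  have c0 := hN.c j (x + 1)
  have c1 := hN.c (j + 1) (x + 1)
  have d0 := hN.d j (x + 1)
  have e : j + 1 + 1 = j + 2 := rfl
  rw [e] at c1
  omega

lemma prev_of_not_fr {N : ℕ → ℤ → ℤ} (hN : Loc N) {j : ℕ} {x : ℤ} (h : fr N j (x + 1)) (h' : ¬ fr N j x) :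
    N (j + 1) x = N j (x + 1) + 1 := by
  unfold fr at h h'
  rw [add_sub_cancel_right] at h
  have a0 := hN.a j x
  have b0 := hN.b j x
  have a2 := hN.a (j + 2) (x - 1)
  have b2 := hN.b (j + 2) (x - 1)
  have c0 := hN.c j x
  have c1 := hN.c (j + 1) x
  have d0 := hN.d (j + 1) (x - 1)
  have e : j + 1 + 1 = j + 2 := rfl
  rw [e] at c1 d0
  rw [sub_add_cancel] at a2 b2 d0
  omega

lemma refl_letter {W : ℤ} {N : ℕ → ℤ → ℤ} (hN : Loc N) (hW : Win W N) {j : ℕ} {t y : ℤ} (h : lf N j t y) :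
    refl N j t (j + 1) y = N j y ∨ refl N j t (j + 1) y = N j y + 1 := by
  rw [refl_eq, if_pos h]
  obtain ⟨h1, h2, h3⟩ := rho_spec hN hW h
  have := fr_letter hN h1.2
  omega

lemma refl_loc {W : ℤ} {N : ℕ → ℤ → ℤ} (hN : Loc N) (hW : Win W N) (j : ℕ) (t : ℤ)
    (hcut : fr N j (t + 1) → N (j + 1) (t + 1) = N j (t + 1)) : Loc (refl N j t) := by
  have d1 : ∀ x, refl N j t (j + 1) (x + 1) ≤ refl N j t (j + 1) x ∧
      refl N j t (j + 1) x ≤ refl N j t (j + 1) (x + 1) + 1 := by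
    intro x
    by_cases h1 : lf N j t x
    · have l1 := refl_letter hN hW h1
      have hj : N j (x + 1) = N j x := h1.2.1
      by_cases h2 : lf N j t (x + 1)
      · rw [refl_eq, refl_eq, if_pos h1, if_pos h2, rho_succ hj, hj]
        have := hN.a (j + 1) (rho N j t (x + 1))
        have := hN.b (j + 1) (rho N j t (x + 1))
        omega
      · have : N (j + 1) (x + 1) = N j (x + 1) := by
          by_cases h3 : fr N j (x + 1)
          · have : x = t := by
              unfold lf at h1 h2
              by_contra hne
              exact h2 ⟨by omega, h3⟩
            subst this
            exact hcut h3
          · exact next_of_not_fr hN h1.2 h3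
        have e : refl N j t (j + 1) (x + 1) = N (j + 1) (x + 1) := by rw [refl_eq, if_neg h2]
        omega
    · have e : refl N j t (j + 1) x = N (j + 1) x := by rw [refl_eq, if_neg h1]
      by_cases h2 : lf N j t (x + 1)
      · have l1 := refl_letter hN hW h2
        have : ¬ fr N j x := fun h => h1 ⟨by have := h2.1; omega, h⟩
        have := prev_of_not_fr hN h2.2 this
        omega
      · rw [e, refl_eq, if_neg h2]
        exact ⟨hN.a _ _, hN.b _ _⟩
  have low : ∀ x, N j x ≤ refl N j t (j + 1) x ∧ refl N j t (j + 1) x ≤ N j (x + 1) + 1 ∧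
      refl N j t (j + 1) x ≤ N (j + 2) x ∧ N (j + 2) (x - 1) ≤ refl N j t (j + 1) x + 1 := by
    intro x
    by_cases h1 : lf N j t x
    · have l1 := refl_letter hN hW h1
      obtain ⟨a1, a2, a3⟩ := h1.2
      omega
    · rw [refl_eq, if_neg h1]
      have := hN.d (j + 1) (x - 1)
      rw [sub_add_cancel] at this
      exact ⟨hN.c _ _, hN.d _ _, hN.c _ _, this⟩
  refine ⟨?_, ?_, ?_, ?_⟩
  · intro h x
    by_cases hh : h = j + 1
    · subst hh; exact (d1 x).1
    · rw [refl_ne _ _ _ _ hh]; exact hN.a h x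
  · intro h x
    by_cases hh : h = j + 1
    · subst hh; exact (d1 x).2
    · rw [refl_ne _ _ _ _ hh]; exact hN.b h x
  · intro h x
    by_cases hh : h = j + 1
    · subst hh; rw [refl_ne _ _ _ (j + 1 + 1) (by omega)]; exact (low x).2.2.1
    · rw [refl_ne _ _ _ _ hh]
      by_cases h2 : h = j
      · subst h2; exact (low x).1
      · rw [refl_ne _ _ _ (h + 1) (by omega)]; exact hN.c h x
  · intro h x
    by_cases hh : h = j + 1
    · subst hh; rw [refl_ne _ _ _ (j + 1 + 1) (by omega)]
      have := (low (x + 1)).2.2.2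
      rwa [add_sub_cancel_right] at this
    · rw [refl_ne _ _ _ _ hh]
      by_cases h2 : h = j
      · subst h2; exact (low x).2.1
      · rw [refl_ne _ _ _ (h + 1) (by omega)]; exact hN.d h x

lemma refl_obj {L : ℕ} {P0 P1 : ℤ → ℤ} {W : ℤ} {N : ℕ → ℤ → ℤ} (hN : IsObj L P0 P1 N) (hW : AgreeOff W P0 P1)
    (j : ℕ) (hj : j + 1 < L) (t : ℤ)
    (hcut : fr N j (t + 1) → N (j + 1) (t + 1) = N j (t + 1)) : IsObj L P0 P1 (refl N j t) :=
  ⟨refl_loc hN.loc (hN.win hW) j t hcut, by rw [refl_ne _ _ _ _ (by omega), hN.bot],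
    fun h hh => by rw [refl_ne _ _ _ _ (by omega), hN.top h hh]⟩

lemma ff_refl_gt (N : ℕ → ℤ → ℤ) (j : ℕ) (t y : ℤ) (hy : t < y) : ff (refl N j t) j y = ff N j y := by
  unfold ff
  simp only [fr_refl, refl_gt N j t y hy, refl_ne N j t j (by omega : j ≠ j + 1)]

lemma ff_refl_le {W : ℤ} {N : ℕ → ℤ → ℤ} (hN : Loc N) (hW : Win W N) (j : ℕ) (t y : ℤ) (hy : y ≤ t) :
    ff (refl N j t) j y = if lf N j t y then - ff N j (rho N j t y) else 0 := by
  by_cases h : fr N j y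
  · have hl : lf N j t y := ⟨hy, h⟩
    obtain ⟨h1, h2, h3⟩ := rho_spec hN hW hl
    rw [if_pos hl]
    unfold ff
    rw [if_pos ((fr_refl N j t y).2 h), if_pos h1.2, refl_eq, if_pos hl, refl_ne _ _ _ j (by omega), h2]
    ring
  · have hl : ¬ lf N j t y := fun hl => h hl.2
    rw [if_neg hl]
    unfold ff
    rw [if_neg (fun h' => h ((fr_refl N j t y).1 h'))]

lemma refl_sum {W : ℤ} {N : ℕ → ℤ → ℤ} (hN : Loc N) (hW : Win W N) (j : ℕ) (t : ℤ) :
    ∑ y ∈ Ico (-W) (t + 1), ff (refl N j t) j y = - ∑ y ∈ Ico (-W) (t + 1), ff N j y := by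
  rw [← sum_neg_distrib]
  have e1 : ∑ y ∈ Ico (-W) (t + 1), ff (refl N j t) j y
      = ∑ y ∈ Ico (-W) (t + 1) with lf N j t y, - ff N j (rho N j t y) := by
    rw [sum_filter]
    refine sum_congr rfl fun y hy => ?_
    rw [mem_Ico] at hy
    exact ff_refl_le hN hW j t y (by omega)
  have e2 : ∑ y ∈ Ico (-W) (t + 1), - ff N j y = ∑ y ∈ Ico (-W) (t + 1) with lf N j t y, - ff N j y := by
    rw [sum_filter]
    refine sum_congr rfl fun y hy => ?_
    rw [mem_Ico] at hy
    split_ifs with hl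
    · rfl
    · unfold ff; rw [if_neg (fun h => hl ⟨by omega, h⟩)]; simp
  rw [e1, e2]
  have memb : ∀ y ∈ {y ∈ Ico (-W) (t + 1) | lf N j t y}, rho N j t y ∈ {y ∈ Ico (-W) (t + 1) | lf N j t y} := by
    intro y hy
    rw [mem_filter] at *
    obtain ⟨h1, h2, h3⟩ := rho_spec hN hW hy.2
    have := fr_win hW h1.2
    refine ⟨?_, h1⟩
    rw [mem_Ico]
    have := h1.1
    omega
  refine sum_bij' (fun y _ => rho N j t y) (fun y _ => rho N j t y) memb memb ?_ ?_ ?_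
  · intro y hy; exact (rho_spec hN hW (mem_filter.1 hy).2).2.2
  · intro y hy; exact (rho_spec hN hW (mem_filter.1 hy).2).2.2
  · intro y hy; rfl

end FFLP

namespace FFLP
open Finset

def beta (W : ℤ) (P Q : ℕ → ℤ → ℤ) (j : ℕ) (x : ℤ) : Prop :=
  CC W P Q j (x + 1) ≤ 0 ∧ ((Q j x ≤ P j x ∧ ff P j x = 1 ∧ ff Q j x = -1) ∨
    (P j x < Q j x ∧ ff P j x = -1 ∧ ff Q j x = 1))

def bad (W : ℤ) (P Q : ℕ → ℤ → ℤ) (j : ℕ) (x : ℤ) : Prop := CC W P Q j x < 0 ∨ beta W P Q j x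

def HW (L : ℕ) (W : ℤ) (P Q : ℕ → ℤ → ℤ) : Prop := ∀ j x, j + 1 < L → ¬ bad W P Q j x

structure Sel (L : ℕ) (W : ℤ) (P Q : ℕ → ℤ → ℤ) (j : ℕ) (x : ℤ) : Prop where
  lt : j + 1 < L
  bad : bad W P Q j x
  later : ∀ j' x', j' + 1 < L → (x < x' ∨ x' = x ∧ j < j') → ¬ FFLP.bad W P Q j' x'

def uncl (W : ℤ) (P Q : ℕ → ℤ → ℤ) (j : ℕ) (x : ℤ) : Prop := fr P j x ∧ fr Q j x ∧ CC W P Q j (x + 1) = 0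

open Classical in
noncomputable def cutP (W : ℤ) (P Q : ℕ → ℤ → ℤ) (j : ℕ) (x : ℤ) : ℤ :=
  if uncl W P Q j x ∧ Q j x ≤ P j x then x else x - 1

open Classical in
noncomputable def cutQ (W : ℤ) (P Q : ℕ → ℤ → ℤ) (j : ℕ) (x : ℤ) : ℤ :=
  if uncl W P Q j x ∧ P j x < Q j x then x else x - 1

/-- local data for a colour at the selected cell -/
def Ucut (N : ℕ → ℤ → ℤ) (j : ℕ) (x t : ℤ) : Prop :=
  (t = x ∧ fr N j x ∧ N (j + 1) (x + 1) = N j (x + 1)) ∨ (t = x - 1 ∧ (fr N j x → N (j + 1) x = N j x))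

structure PC (W : ℤ) (P Q : ℕ → ℤ → ℤ) : Prop where
  lP : Loc P
  lQ : Loc Q
  wP : Win W P
  wQ : Win W Q

lemma Sel.unique {L : ℕ} {W : ℤ} {P Q : ℕ → ℤ → ℤ} {j j' : ℕ} {x x' : ℤ} (h : Sel L W P Q j x)
    (h' : Sel L W P Q j' x') : j = j' ∧ x = x' := by
  have h1 := h.later j' x' h'.lt
  have h2 := h'.later j x h.lt
  by_contra hne
  by_cases c : x < x' ∨ x' = x ∧ j < j'
  · exact h1 c h'.bad
  · exact h2 (by omega) h.bad

lemma bad_lt {W : ℤ} {P Q : ℕ → ℤ → ℤ} (h : PC W P Q) {j : ℕ} {x : ℤ} (hb : bad W P Q j x) : x < W := by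
  by_contra hx
  rcases hb with hb | hb
  · rw [CC_top _ _ _ _ (by omega)] at hb; omega
  · have := ff_off h.wP j x (by omega)
    have := hb.2
    omega

lemma Sel.next {L : ℕ} {W : ℤ} {P Q : ℕ → ℤ → ℤ} {j : ℕ} {x : ℤ}
    (h : Sel L W P Q j x) (y : ℤ) (hy : x < y) : 0 ≤ CC W P Q j y := by
  by_contra hlt
  exact h.later j y h.lt (Or.inl hy) (Or.inl (by omega))

lemma Sel.ge {L : ℕ} {W : ℤ} {P Q : ℕ → ℤ → ℤ} (hpc : PC W P Q) {j : ℕ} {x : ℤ}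
    (h : Sel L W P Q j x) : -W ≤ x := by
  by_contra hx
  have e1 := ff_off hpc.wP j x (by omega)
  have e2 := ff_off hpc.wQ j x (by omega)
  have r := CC_rec hpc.wP hpc.wQ j x
  have n := h.next (x + 1) (by omega)
  rw [cc] at r
  rcases h.bad with hb | hb
  · omega
  · have := hb.2; omega

lemma exists_sel {L : ℕ} {W : ℤ} {P Q : ℕ → ℤ → ℤ} (hpc : PC W P Q) (h : ¬ HW L W P Q) :
    ∃ j x, Sel L W P Q j x := by
  classical
  unfold HW at h
  push Not at h
  obtain ⟨j0, x0, hj0, hb0⟩ := h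
  obtain ⟨x, ⟨j1, hj1, hb1⟩, hx⟩ := Int.exists_greatest_of_bdd
    (P := fun x => ∃ j, j + 1 < L ∧ bad W P Q j x)
    ⟨W, fun z ⟨j, _, hb⟩ => (bad_lt hpc hb).le⟩ ⟨x0, j0, hj0, hb0⟩
  obtain ⟨j, hj, hm⟩ := exists_max_image {j ∈ range L | j + 1 < L ∧ bad W P Q j x} id
    ⟨j1, by rw [mem_filter, mem_range]; exact ⟨by omega, hj1, hb1⟩⟩
  rw [mem_filter] at hj
  refine ⟨j, x, hj.2.1, hj.2.2, ?_⟩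
  intro j' x' hj' hl hb
  rcases hl with hl | ⟨rfl, hl⟩
  · have := hx x' ⟨j', hj', hb⟩; omega
  · have := hm j' (by rw [mem_filter, mem_range]; exact ⟨by omega, hj', hb⟩)
    simp only [id] at this
    omega

/-- summary of the facts at the selected cell -/
lemma sel_facts {L : ℕ} {W : ℤ} {P Q : ℕ → ℤ → ℤ} (hpc : PC W P Q) {j : ℕ} {x : ℤ}
    (h : Sel L W P Q j x) :
    Ucut P j x (cutP W P Q j x) ∧ Ucut Q j x (cutQ W P Q j x) ∧
    ((¬ uncl W P Q j x ∧ cutP W P Q j x = x - 1 ∧ cutQ W P Q j x = x - 1 ∧ CC W P Q j x = -1) ∨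
     (uncl W P Q j x ∧ Q j x ≤ P j x ∧ cutP W P Q j x = x ∧ cutQ W P Q j x = x - 1) ∨
     (uncl W P Q j x ∧ P j x < Q j x ∧ cutP W P Q j x = x - 1 ∧ cutQ W P Q j x = x)) := by
  have n1 := h.next (x + 1) (by omega)
  have n2 := h.next (x + 1 + 1) (by omega)
  have r1 := CC_rec hpc.wP hpc.wQ j x
  have r2 := CC_rec hpc.wP hpc.wQ j (x + 1)
  rw [cc] at r1 r2
  have fP := ff_cases hpc.lP j x
  have fQ := ff_cases hpc.lQ j x
  have fP1 := ff_cases hpc.lP j (x + 1)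
  have fQ1 := ff_cases hpc.lQ j (x + 1)
  have hb := h.bad
  have nb1 := h.later j (x + 1) h.lt (Or.inl (by omega))
  unfold bad beta at hb nb1
  by_cases hu : uncl W P Q j x
  · obtain ⟨hu1, hu2, hu3⟩ := hu
    have eP := hu1.1
    have eQ := hu2.1
    rcases le_or_gt (Q j x) (P j x) with hs | hs
    · have c1 : cutP W P Q j x = x := by unfold cutP; rw [if_pos ⟨⟨hu1, hu2, hu3⟩, hs⟩]
      have c2 : cutQ W P Q j x = x - 1 := by unfold cutQ; rw [if_neg (by rintro ⟨_, h⟩; omega)]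
      refine ⟨Or.inl ⟨c1, hu1, ?_⟩, Or.inr ⟨c2, fun _ => ?_⟩, Or.inr (Or.inl ⟨⟨hu1, hu2, hu3⟩, hs, c1, c2⟩)⟩
      · by_cases hf : fr P j (x + 1)
        · by_contra hne
          apply nb1
          right
          refine ⟨?_, Or.inl ⟨?_, ?_, ?_⟩⟩ <;> grind
        · exact next_of_not_fr hpc.lP hu1 hf
      · grind
    · have c1 : cutP W P Q j x = x - 1 := by unfold cutP; rw [if_neg (by rintro ⟨_, h⟩; omega)]
      have c2 : cutQ W P Q j x = x := by unfold cutQ; rw [if_pos ⟨⟨hu1, hu2, hu3⟩, hs⟩]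
      refine ⟨Or.inr ⟨c1, fun _ => ?_⟩, Or.inl ⟨c2, hu2, ?_⟩, Or.inr (Or.inr ⟨⟨hu1, hu2, hu3⟩, hs, c1, c2⟩)⟩
      · grind
      · by_cases hf : fr Q j (x + 1)
        · by_contra hne
          apply nb1
          right
          refine ⟨?_, Or.inr ⟨?_, ?_, ?_⟩⟩ <;> grind
        · exact next_of_not_fr hpc.lQ hu2 hf
  · have c1 : cutP W P Q j x = x - 1 := by unfold cutP; rw [if_neg (by rintro ⟨h, _⟩; exact hu h)]
    have c2 : cutQ W P Q j x = x - 1 := by unfold cutQ; rw [if_neg (by rintro ⟨h, _⟩; exact hu h)]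
    have hu' := hu
    unfold uncl at hu'
    have hC1 : fr P j x → fr Q j x → CC W P Q j (x + 1) ≠ 0 := fun a b c => hu' ⟨a, b, c⟩
    have hb' : CC W P Q j x < 0 := by
      rcases hb with hb | hb
      · exact hb
      · exfalso
        have q1 : fr P j x := by
          by_contra hn
          rcases fP with fP | fP | fP
          · omega
          · exact hn fP.1
          · exact hn fP.1
        have q2 : fr Q j x := by
          by_contra hn
          rcases fQ with fQ | fQ | fQ
          · omega
          · exact hn fQ.1
          · exact hn fQ.1
        exact hC1 q1 q2 (by omega)
    clear hb nb1 hu' fP1 fQ1 r2 n2 h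
    refine ⟨Or.inr ⟨c1, fun hf => ?_⟩, Or.inr ⟨c2, fun hf => ?_⟩, Or.inl ⟨hu, c1, c2, ?_⟩⟩
    · rcases fP with fP | fP | fP
      · exact absurd hf fP.1
      · rcases fQ with fQ | fQ | fQ
        · omega
        · omega
        · have := hC1 hf fQ.1; omega
      · exact fP.2.2
    · rcases fQ with fQ | fQ | fQ
      · exact absurd hf fQ.1
      · rcases fP with fP | fP | fP
        · omega
        · omega
        · have := hC1 fP.1 hf; omega
      · exact fQ.2.2
    · rcases fP with fP | fP | fP <;> rcases fQ with fQ | fQ | fQ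
      all_goals first | omega | (have := hC1 fP.1 fQ.1; omega)

lemma Ucut.cut {N : ℕ → ℤ → ℤ} {j : ℕ} {x t : ℤ} (h : Ucut N j x t) :
    fr N j (t + 1) → N (j + 1) (t + 1) = N j (t + 1) := by
  rcases h with ⟨rfl, _, h⟩ | ⟨rfl, h⟩
  · exact fun _ => h
  · rw [sub_add_cancel]; exact h

lemma Ucut.le {N : ℕ → ℤ → ℤ} {j : ℕ} {x t : ℤ} (h : Ucut N j x t) : t ≤ x := by
  rcases h with ⟨rfl, _, h⟩ | ⟨rfl, h⟩ <;> omega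

lemma ff_congr {N M : ℕ → ℤ → ℤ} {j : ℕ} {y : ℤ} (h1 : N j y = M j y) (h2 : N j (y + 1) = M j (y + 1))
    (h3 : N (j + 1) y = M (j + 1) y) (h4 : N (j + 2) (y - 1) = M (j + 2) (y - 1))
    (h5 : N (j + 2) y = M (j + 2) y) : ff N j y = ff M j y := by
  have : fr N j y ↔ fr M j y := by unfold fr; rw [h1, h2, h4, h5]
  unfold ff; simp only [this, h1, h3]

lemma ff_later (N : ℕ → ℤ → ℤ) (j : ℕ) (t : ℤ) (j' : ℕ) (y : ℤ)
    (h : (j' = j ∧ t < y) ∨ (j' = j + 1 ∧ t < y) ∨ (j' + 1 = j ∧ t < y - 1) ∨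
      (j' ≠ j ∧ j' ≠ j + 1 ∧ j' + 1 ≠ j)) : ff (refl N j t) j' y = ff N j' y := by
  have key : ∀ (h : ℕ) (z : ℤ), (h ≠ j + 1 ∨ t < z) → refl N j t h z = N h z := by
    intro h z hz
    by_cases hh : h = j + 1
    · subst hh; exact refl_gt N j t z (by omega)
    · rw [refl_ne _ _ _ _ hh]
  apply ff_congr <;> apply key <;> omega

lemma Ucut.nonneg {N : ℕ → ℤ → ℤ} (hN : Loc N) {j : ℕ} {x : ℤ} (hf : fr N j x)
    (h : N (j + 1) x = N j x ∨ N (j + 1) (x + 1) = N j (x + 1)) : 0 ≤ ff N (j + 1) x := by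
  rcases ff_cases hN (j + 1) x with h1 | h1 | h1
  · omega
  · omega
  · exfalso
    obtain ⟨⟨a1, a2, a3⟩, h2, h3⟩ := h1
    obtain ⟨b1, b2, b3⟩ := hf
    have e : j + 1 + 1 = j + 2 := rfl
    rw [e] at h3
    omega

lemma Ucut.nonneg' {N : ℕ → ℤ → ℤ} (hN : Loc N) {j : ℕ} {x : ℤ} (hf : fr N (j + 1) x)
    (h : N (j + 1 + 1) x = N (j + 1) x ∨ N (j + 1 + 1) (x + 1) = N (j + 1) (x + 1)) : 0 ≤ ff N j (x + 1) := by
  rcases ff_cases hN j (x + 1) with h1 | h1 | h1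
  · omega
  · omega
  · exfalso
    obtain ⟨⟨a1, a2, a3⟩, h2, h3⟩ := h1
    obtain ⟨b1, b2, b3⟩ := hf
    have e : j + 1 + 1 = j + 2 := rfl
    rw [e] at h
    rw [add_sub_cancel_right] at a2
    have := hN.a (j + 1) x
    have := hN.c (j + 1) x
    omega

lemma Ucut.refl_nonneg {W : ℤ} {N : ℕ → ℤ → ℤ} (hN : Loc N) (hW : Win W N) {j : ℕ} {x t : ℤ} (hf : fr N j x)
    (h : Ucut N j x t) : 0 ≤ ff (refl N j t) (j + 1) x ∧ ∀ i, j = i + 1 → 0 ≤ ff (refl N j t) i (x + 1) := by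
  have hl := refl_loc hN hW j t h.cut
  have hf' := (fr_refl N j t x).2 hf
  have : refl N j t (j + 1) x = refl N j t j x ∨ refl N j t (j + 1) (x + 1) = refl N j t j (x + 1) := by
    rw [refl_ne N j t j (by omega)]
    rcases h with ⟨rfl, _, h⟩ | ⟨rfl, h⟩
    · right; rw [refl_gt _ _ _ _ (by omega), h]
    · left; rw [refl_gt _ _ _ _ (by omega), h hf]
  refine ⟨Ucut.nonneg hl hf' this, ?_⟩
  rintro i rfl
  exact Ucut.nonneg' hl hf' this

lemma CC_congr {W : ℤ} {P Q P' Q' : ℕ → ℤ → ℤ} {j : ℕ} {x : ℤ}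
    (h1 : ∀ y, x ≤ y → ff P' j y = ff P j y) (h2 : ∀ y, x ≤ y → ff Q' j y = ff Q j y) :
    CC W P' Q' j x = CC W P Q j x := by
  unfold CC cc
  refine sum_congr rfl fun y hy => ?_
  rw [mem_Ico] at hy
  rw [h1 y hy.1, h2 y hy.1]

lemma bad_congr {W : ℤ} {P Q P' Q' : ℕ → ℤ → ℤ} {j : ℕ} {x : ℤ}
    (h1 : ∀ y, x ≤ y → ff P' j y = ff P j y) (h2 : ∀ y, x ≤ y → ff Q' j y = ff Q j y)
    (h3 : P' j x = P j x) (h4 : Q' j x = Q j x) : bad W P' Q' j x ↔ bad W P Q j x := by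
  unfold bad beta
  rw [CC_congr h1 h2, CC_congr (fun y hy => h1 y (by omega)) (fun y hy => h2 y (by omega)), h1 x le_rfl,
    h2 x le_rfl, h3, h4]

lemma win_refl {W : ℤ} {N : ℕ → ℤ → ℤ} (hW : Win W N) (j : ℕ) (t : ℤ) : Win W (refl N j t) := by
  have : ∀ h x, (x < -W ∨ W ≤ x) → refl N j t h x = N h x := by
    intro h x hx
    by_cases hh : h = j + 1
    · subst hh
      rw [refl_eq, if_neg]
      intro hl
      have := fr_win hW hl.2
      omega
    · rw [refl_ne _ _ _ _ hh]
  intro h h' x hx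
  rw [this h x hx, this h' x hx, hW h h' x hx]

section step
variable {L : ℕ} {W : ℤ} {P Q : ℕ → ℤ → ℤ} {j : ℕ} {x : ℤ}

lemma step_pc (hpc : PC W P Q) (h : Sel L W P Q j x) :
    PC W (refl P j (cutP W P Q j x)) (refl Q j (cutQ W P Q j x)) := by
  obtain ⟨u1, u2, _⟩ := sel_facts hpc h
  exact ⟨refl_loc hpc.lP hpc.wP j _ u1.cut, refl_loc hpc.lQ hpc.wQ j _ u2.cut, win_refl hpc.wP _ _, win_refl hpc.wQ _ _⟩

lemma step_CC (hpc : PC W P Q) (h : Sel L W P Q j x) (y : ℤ) (hy : x < y) :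
    CC W (refl P j (cutP W P Q j x)) (refl Q j (cutQ W P Q j x)) j y = CC W P Q j y := by
  obtain ⟨u1, u2, _⟩ := sel_facts hpc h
  have := u1.le
  have := u2.le
  exact CC_congr (fun z hz => ff_refl_gt _ _ _ _ (by omega)) (fun z hz => ff_refl_gt _ _ _ _ (by omega))

lemma step_uncl (hpc : PC W P Q) (h : Sel L W P Q j x) :
    uncl W (refl P j (cutP W P Q j x)) (refl Q j (cutQ W P Q j x)) j x ↔ uncl W P Q j x := by
  unfold uncl
  rw [step_CC hpc h _ (by omega), fr_refl, fr_refl]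

lemma step_cut (hpc : PC W P Q) (h : Sel L W P Q j x) :
    cutP W (refl P j (cutP W P Q j x)) (refl Q j (cutQ W P Q j x)) j x = cutP W P Q j x ∧
    cutQ W (refl P j (cutP W P Q j x)) (refl Q j (cutQ W P Q j x)) j x = cutQ W P Q j x := by
  have := step_uncl hpc h
  generalize hP : cutP W P Q j x = a at *
  generalize hQ : cutQ W P Q j x = b at *
  unfold cutP cutQ at *
  rw [this, refl_ne P j _ j (by omega), refl_ne Q j _ j (by omega), hP, hQ]
  exact ⟨rfl, rfl⟩

lemma step_sel (hpc : PC W P Q) (h : Sel L W P Q j x) :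
    Sel L W (refl P j (cutP W P Q j x)) (refl Q j (cutQ W P Q j x)) j x := by
  have hpc' := step_pc hpc h
  have hCC := step_CC hpc h
  obtain ⟨u1, u2, hc⟩ := sel_facts hpc h
  generalize hP : cutP W P Q j x = a at *
  generalize hQ : cutQ W P Q j x = b at *
  have ha := u1.le
  have hb := u2.le
  refine ⟨h.lt, ?_, ?_⟩
  · rcases hc with ⟨hu, rfl, rfl, hC⟩ | ⟨⟨f1, f2, f3⟩, hs, rfl, rfl⟩ | ⟨⟨f1, f2, f3⟩, hs, rfl, rfl⟩
    · left
      rw [CC_congr (fun z hz => ff_refl_gt _ _ _ _ (by omega)) (fun z hz => ff_refl_gt _ _ _ _ (by omega)), hC]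
      norm_num
    · unfold bad beta
      rw [CC_rec hpc'.wP hpc'.wQ, hCC _ (by omega), f3, cc]
      rw [refl_ne P j _ j (by omega), refl_ne Q j _ j (by omega)]
      have g1 := ff_cases hpc'.lP j a
      have g2 := ff_cases hpc'.lQ j a
      rw [fr_refl, refl_ne _ _ _ j (by omega)] at g1 g2
      have g3 : refl Q j (a - 1) (j + 1) a = Q (j + 1) a := refl_gt _ _ _ _ (by omega)
      rcases u2 with u2 | u2
      · omega
      · have := u2.2 f2
        grind
    · unfold bad beta
      rw [CC_rec hpc'.wP hpc'.wQ, hCC _ (by omega), f3, cc]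
      rw [refl_ne P j _ j (by omega), refl_ne Q j _ j (by omega)]
      have g1 := ff_cases hpc'.lP j b
      have g2 := ff_cases hpc'.lQ j b
      rw [fr_refl, refl_ne _ _ _ j (by omega)] at g1 g2
      have g3 : refl P j (b - 1) (j + 1) b = P (j + 1) b := refl_gt _ _ _ _ (by omega)
      rcases u1 with u1 | u1
      · omega
      · have := u1.2 f1
        grind
  · intro j' x' hj' hl
    have hnb := h.later j' x' hj' hl
    -- the two exceptional cells
    by_cases hex : uncl W P Q j x ∧ ((j' = j + 1 ∧ x' = x) ∨ (j' + 1 = j ∧ x' = x + 1))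
    · obtain ⟨⟨f1, f2, f3⟩, hex⟩ := hex
      have k1 := Ucut.refl_nonneg hpc.lP hpc.wP f1 u1
      have k2 := Ucut.refl_nonneg hpc.lQ hpc.wQ f2 u2
      have m1 : 0 ≤ ff (refl P j a) j' x' := by
        rcases hex with ⟨rfl, rfl⟩ | ⟨rfl, rfl⟩
        · exact k1.1
        · exact k1.2 _ rfl
      have m2 : 0 ≤ ff (refl Q j b) j' x' := by
        rcases hex with ⟨rfl, rfl⟩ | ⟨rfl, rfl⟩
        · exact k2.1
        · exact k2.2 _ rfl
      have hC : CC W (refl P j a) (refl Q j b) j' (x' + 1) = CC W P Q j' (x' + 1) :=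
        CC_congr (fun z hz => ff_later _ _ _ _ _ (by omega)) (fun z hz => ff_later _ _ _ _ _ (by omega))
      have hC0 : 0 ≤ CC W P Q j' (x' + 1) := by
        by_contra hlt
        exact h.later j' (x' + 1) hj' (Or.inl (by omega)) (Or.inl (by omega))
      have r := CC_rec hpc'.wP hpc'.wQ j' x'
      rw [cc] at r
      rintro (hb | hb)
      · omega
      · have := hb.2; omega
    · have gen : ∀ y, x' ≤ y → ((j' = j ∧ x < y) ∨ (j' = j + 1 ∧ a < y ∧ b < y) ∨ (j' + 1 = j ∧ a < y - 1 ∧ b < y - 1) ∨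
          (j' ≠ j ∧ j' ≠ j + 1 ∧ j' + 1 ≠ j)) := by
        intro y hy
        by_cases hu : uncl W P Q j x
        · have : ¬ ((j' = j + 1 ∧ x' = x) ∨ (j' + 1 = j ∧ x' = x + 1)) := fun h => hex ⟨hu, h⟩
          omega
        · rcases hc with hc | hc | hc
          · omega
          · exact absurd hc.1 hu
          · exact absurd hc.1 hu
      rw [bad_congr]
      · exact hnb
      · intro y hy; apply ff_later; have := gen y hy; omega
      · intro y hy; apply ff_later; have := gen y hy; omega
      · by_cases hh : j' = j + 1
        · subst hh; apply refl_gt; have := gen x' le_rfl; omega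
        · rw [refl_ne _ _ _ _ hh]
      · by_cases hh : j' = j + 1
        · subst hh; apply refl_gt; have := gen x' le_rfl; omega
        · rw [refl_ne _ _ _ _ hh]

lemma sum_split (g : ℤ → ℤ) (W t : ℤ) (h1 : -W ≤ t) (h2 : t ≤ W) :
    ∑ y ∈ Ico (-W) W, g y = ∑ y ∈ Ico (-W) t, g y + ∑ y ∈ Ico t W, g y := by
  rw [← sum_union]
  · congr 1; ext a; simp only [mem_union, mem_Ico]; omega
  · rw [disjoint_left]; intro a; simp only [mem_Ico]; omega

lemma refl_ff_sum {N : ℕ → ℤ → ℤ} (hN : Loc N) (hW : Win W N) (j : ℕ) (t : ℤ) (h1 : -W ≤ t + 1) (h2 : t + 1 ≤ W) :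
    ∑ y ∈ Ico (-W) W, ff (refl N j t) j y
      = - ∑ y ∈ Ico (-W) W, ff N j y + 2 * ∑ y ∈ Ico (t + 1) W, ff N j y := by
  rw [sum_split _ W (t + 1) h1 h2, sum_split (ff N j) W (t + 1) h1 h2, refl_sum hN hW]
  have : ∑ y ∈ Ico (t + 1) W, ff (refl N j t) j y = ∑ y ∈ Ico (t + 1) W, ff N j y := by
    refine sum_congr rfl fun y hy => ff_refl_gt _ _ _ _ ?_
    rw [mem_Ico] at hy; omega
  rw [this]; ring

lemma step_wt (hpc : PC W P Q) (h : Sel L W P Q j x) :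
    wt W (refl P j (cutP W P Q j x)) j + wt W (refl Q j (cutQ W P Q j x)) j = wt W P (j + 1) + wt W Q (j + 1) - 1 ∧
    wt W (refl P j (cutP W P Q j x)) (j + 1) + wt W (refl Q j (cutQ W P Q j x)) (j + 1) = wt W P j + wt W Q j + 1 := by
  have hpc' := step_pc hpc h
  have hlt := bad_lt hpc h.bad
  have hge := h.ge hpc
  obtain ⟨u1, u2, hc⟩ := sel_facts hpc h
  generalize hP : cutP W P Q j x = a at *
  generalize hQ : cutQ W P Q j x = b at *
  have ha := u1.le
  have hb := u2.le
  have W0 : 0 ≤ W := by omega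
  have e1 := wt_diff W0 hpc.lP hpc.wP j
  have e2 := wt_diff W0 hpc.lQ hpc.wQ j
  have e3 := wt_diff W0 hpc'.lP hpc'.wP j
  have e4 := wt_diff W0 hpc'.lQ hpc'.wQ j
  have ha' : x - 1 ≤ a := by omega
  have hb' : x - 1 ≤ b := by omega
  rw [refl_ff_sum hpc.lP hpc.wP j a (by omega) (by omega)] at e3
  rw [refl_ff_sum hpc.lQ hpc.wQ j b (by omega) (by omega)] at e4
  have cons : ∀ (N : ℕ → ℤ → ℤ) (t : ℤ), wt W (refl N j t) j + wt W (refl N j t) (j + 1) = wt W N j + wt W N (j + 1) := by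
    intro N t
    unfold wt
    rw [← sum_add_distrib, ← sum_add_distrib]
    refine sum_congr rfl fun y _ => ?_
    rw [refl_ne N j t j (by omega), refl_ne N j t (j + 1 + 1) (by omega)]; ring
  have c1 := cons P a
  have c2 := cons Q b
  have pop : ∀ N : ℕ → ℤ → ℤ, ∑ y ∈ Ico x W, ff N j y = ff N j x + ∑ y ∈ Ico (x + 1) W, ff N j y := by
    intro N
    have : Ico x W = insert x (Ico (x + 1) W) := by
      ext a; simp only [mem_insert, mem_Ico]; omega
    rw [this, sum_insert (by simp)]
  have rest : ∑ y ∈ Ico (a + 1) W, ff P j y + ∑ y ∈ Ico (b + 1) W, ff Q j y = -1 := by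
    rcases hc with ⟨hu, rfl, rfl, hC⟩ | ⟨⟨f1, f2, f3⟩, hs, rfl, rfl⟩ | ⟨⟨f1, f2, f3⟩, hs, rfl, rfl⟩
    · rw [sub_add_cancel, ← sum_add_distrib]; exact hC
    · rw [sub_add_cancel, pop Q]
      unfold CC cc at f3
      rw [sum_add_distrib] at f3
      rcases u2 with u2 | u2
      · omega
      · have := u2.2 f2
        have g := ff_cases hpc.lQ j a
        grind
    · rw [sub_add_cancel, pop P]
      unfold CC cc at f3
      rw [sum_add_distrib] at f3
      rcases u1 with u1 | u1
      · omega
      · have := u1.2 f1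
        have g := ff_cases hpc.lP j b
        grind
  constructor <;> omega

end step
end FFLP

namespace FFLP
open Finset

abbrev Pr := (ℕ → ℤ → ℤ) × (ℕ → ℤ → ℤ)

open Classical in
/-- the sign reversing involution -/
noncomputable def phi (L : ℕ) (W : ℤ) (o : Pr) : Pr :=
  if h : ∃ s : ℕ × ℤ, Sel L W o.1 o.2 s.1 s.2 then
    (refl o.1 h.choose.1 (cutP W o.1 o.2 h.choose.1 h.choose.2),
      refl o.2 h.choose.1 (cutQ W o.1 o.2 h.choose.1 h.choose.2))
  else o

lemma phi_eq {L : ℕ} {W : ℤ} {o : Pr} {j : ℕ} {x : ℤ} (h : Sel L W o.1 o.2 j x) :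
    phi L W o = (refl o.1 j (cutP W o.1 o.2 j x), refl o.2 j (cutQ W o.1 o.2 j x)) := by
  have hex : ∃ s : ℕ × ℤ, Sel L W o.1 o.2 s.1 s.2 := ⟨(j, x), h⟩
  unfold phi
  rw [dif_pos hex]
  obtain ⟨e1, e2⟩ := hex.choose_spec.unique h
  rw [e1, e2]

lemma phi_phi {L : ℕ} {W : ℤ} {o : Pr} (hpc : PC W o.1 o.2) {j : ℕ} {x : ℤ} (h : Sel L W o.1 o.2 j x) :
    phi L W (phi L W o) = o := by
  have h' := step_sel hpc h
  have hc := step_cut hpc h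
  have e := phi_eq h
  rw [e]
  rw [phi_eq (o := (refl o.1 j (cutP W o.1 o.2 j x), refl o.2 j (cutQ W o.1 o.2 j x))) h']
  simp only [hc.1, hc.2]
  rw [refl_refl hpc.lP hpc.wP, refl_refl hpc.lQ hpc.wQ]

noncomputable def pw (W : ℤ) (o : Pr) (i : ℕ) : ℕ := (wt W o.1 i).toNat + (wt W o.2 i).toNat

lemma pw_eq {W : ℤ} {o : Pr} (hpc : PC W o.1 o.2) (i : ℕ) : (pw W o i : ℤ) = wt W o.1 i + wt W o.2 i := by
  have := wt_nonneg (W := W) hpc.lP i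
  have := wt_nonneg (W := W) hpc.lQ i
  unfold pw; push_cast; omega

lemma phi_alt {R : Type*} [CommRing R] (z : ℕ → R) {L : ℕ} {W : ℤ} {o : Pr} (hpc : PC W o.1 o.2)
    (h : ¬ HW L W o.1 o.2) :
    alt z L (fun i => pw W (phi L W o) i + (L - 1 - i)) = - alt z L (fun i => pw W o i + (L - 1 - i)) := by
  obtain ⟨j, x, hs⟩ := exists_sel hpc h
  have hj := hs.lt
  have hpc' : PC W (phi L W o).1 (phi L W o).2 := by rw [phi_eq hs]; exact step_pc hpc hs
  have hw := step_wt hpc hs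
  have w : ∀ i, (pw W (phi L W o) i : ℤ) = wt W (refl o.1 j (cutP W o.1 o.2 j x)) i + wt W (refl o.2 j (cutQ W o.1 o.2 j x)) i := by
    intro i; rw [pw_eq hpc', phi_eq hs]
  have w0 := pw_eq hpc
  refine alt_swap z L _ _ ⟨j, by omega⟩ ⟨j + 1, by omega⟩ (by simp) ?_ ?_ ?_
  · have := w j; have := w0 (j + 1); dsimp only; omega
  · have := w (j + 1); have := w0 j; dsimp only; omega
  · intro l h1 h2
    have h1' : (l : ℕ) ≠ j := fun h => h1 (Fin.ext h)
    have h2' : (l : ℕ) ≠ j + 1 := fun h => h2 (Fin.ext h)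
    have e : ∀ (N : ℕ → ℤ → ℤ) (t : ℤ), wt W (refl N j t) l = wt W N l := by
      intro N t
      unfold wt
      rw [refl_ne _ _ _ _ h2', refl_ne _ _ _ _ (by omega)]
    have := w l; have := w0 l
    rw [e, e] at *
    omega

section main
variable {L : ℕ} {P0 P1 Q0 Q1 : ℤ → ℤ} {W : ℤ}

lemma obj_pc (hP : AgreeOff W P0 P1) (hQ : AgreeOff W Q0 Q1) {o : Pr}
    (ho : o ∈ X L P0 P1 ×ˢ X L Q0 Q1) : PC W o.1 o.2 := by
  rw [mem_product, mem_X hP, mem_X hQ] at ho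
  exact ⟨ho.1.loc, ho.2.loc, ho.1.win hP, ho.2.win hQ⟩

open Classical in
lemma sum_bad {R : Type*} [CommRing R] [IsDomain R] [CharZero R] (z : ℕ → R) (hP : AgreeOff W P0 P1) (hQ : AgreeOff W Q0 Q1) :
    ∑ o ∈ X L P0 P1 ×ˢ X L Q0 Q1 with ¬ HW L W o.1 o.2, alt z L (fun i => pw W o i + (L - 1 - i)) = 0 := by
  refine sum_involution (fun o _ => phi L W o) ?_ ?_ ?_ ?_
  · intro o ho
    rw [mem_filter] at ho
    rw [phi_alt z (obj_pc hP hQ ho.1) ho.2, add_neg_cancel]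
  · intro o ho hne he
    rw [mem_filter] at ho
    have := phi_alt z (obj_pc hP hQ ho.1) ho.2
    rw [he] at this
    exact hne (self_eq_neg.1 this)
  · intro o ho
    rw [mem_filter] at ho ⊢
    have hpc := obj_pc hP hQ ho.1
    obtain ⟨j, x, hs⟩ := exists_sel hpc ho.2
    obtain ⟨u1, u2, _⟩ := sel_facts hpc hs
    have ho1 := ho.1
    rw [mem_product, mem_X hP, mem_X hQ] at ho1
    have hs' := step_sel hpc hs
    rw [phi_eq hs]
    refine ⟨?_, fun hw => hw j x hs'.lt hs'.bad⟩
    rw [mem_product, mem_X hP, mem_X hQ]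
    exact ⟨refl_obj ho1.1 hP j hs.lt _ u1.cut, refl_obj ho1.2 hQ j hs.lt _ u2.cut⟩
  · intro o ho
    rw [mem_filter] at ho
    have hpc := obj_pc hP hQ ho.1
    obtain ⟨j, x, hs⟩ := exists_sel hpc ho.2
    exact phi_phi hpc hs

open Classical in
theorem GF_mul (hP : AgreeOff W P0 P1) (hQ : AgreeOff W Q0 Q1)
    (hF : (GF (xv L) W L P0 P1 * GF (xv L) W L Q0 Q1).IsSymmetric) :
    GF (xv L) W L P0 P1 * GF (xv L) W L Q0 Q1 =
      ∑ o ∈ X L P0 P1 ×ˢ X L Q0 Q1 with HW L W o.1 o.2, JT (xv L) L L (fun i => (pw W o i : ℤ) - i) := by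
  have e : GF (xv L) W L P0 P1 * GF (xv L) W L Q0 Q1 =
      ∑ o ∈ X L P0 P1 ×ˢ X L Q0 Q1, ∏ i ∈ range L, xv L i ^ pw W o i := by
    unfold GF
    rw [sum_mul_sum, ← sum_product']
    refine sum_congr rfl fun o _ => ?_
    rw [← prod_mul_distrib]
    exact prod_congr rfl fun i _ => by rw [pw, pow_add]
  apply mul_right_cancel₀ (alt_delta_ne L)
  rw [e] at hF ⊢
  rw [symm_mul_alt L _ _ hF, ← sum_filter_add_sum_filter_not _ (fun o : Pr => HW L W o.1 o.2), sum_bad _ hP hQ, add_zero, sum_mul]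
  exact sum_congr rfl fun o _ => alt_eq_JT _ _ _

lemma HW_anti (hW0 : 0 ≤ W) {o : Pr} (hpc : PC W o.1 o.2) (h : HW L W o.1 o.2) (j : ℕ) (hj : j + 1 < L) :
    pw W o (j + 1) ≤ pw W o j := by
  have h1 : 0 ≤ CC W o.1 o.2 j (-W) := by
    by_contra hn
    exact h j (-W) hj (Or.inl (by omega))
  unfold CC cc at h1
  rw [sum_add_distrib, ← wt_diff hW0 hpc.lP hpc.wP, ← wt_diff hW0 hpc.lQ hpc.wQ] at h1
  have := pw_eq hpc j
  have := pw_eq hpc (j + 1)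
  omega

end main
end FFLP

namespace FFLP
open Finset

def Adj (h : ℕ) (x : ℤ) (h' : ℕ) (x' : ℤ) : Prop :=
  (h' = h ∧ (x' = x + 1 ∨ x = x' + 1)) ∨ (h' = h + 1 ∧ (x' = x ∨ x = x' + 1)) ∨
    (h = h' + 1 ∧ (x' = x ∨ x' = x + 1))

/-- cells connected to the top through nonzero cells -/
inductive ZZ (L : ℕ) (H : ℕ → ℤ → Prop) : ℕ → ℤ → Prop
  | top (h : ℕ) (x : ℤ) (hL : L ≤ h) (hne : H h x) : ZZ L H h x
  | step (h : ℕ) (x : ℤ) (h' : ℕ) (x' : ℤ) (hz : ZZ L H h x) (ha : Adj h x h' x') (hne : H h' x') : ZZ L H h' x'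

lemma ZZ.ne {L : ℕ} {H : ℕ → ℤ → Prop} {h : ℕ} {x : ℤ} (hz : ZZ L H h x) : H h x := by
  cases hz <;> assumption

lemma Adj.symm {h : ℕ} {x : ℤ} {h' : ℕ} {x' : ℤ} (ha : Adj h x h' x') : Adj h' x' h x := by
  unfold Adj at *; omega

lemma Loc.adj {N : ℕ → ℤ → ℤ} (hN : Loc N) {h : ℕ} {x : ℤ} {h' : ℕ} {x' : ℤ} (ha : Adj h x h' x') :
    ((h' = h ∧ x' = x + 1 ∨ h = h' + 1) ∧ N h' x' ≤ N h x ∧ N h x ≤ N h' x' + 1) ∨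
    ((h' = h ∧ x = x' + 1 ∨ h' = h + 1) ∧ N h x ≤ N h' x' ∧ N h' x' ≤ N h x + 1) := by
  rcases ha with ⟨rfl, rfl | rfl⟩ | ⟨rfl, rfl | rfl⟩ | ⟨rfl, rfl | rfl⟩
  · left; have := hN.a h' x; have := hN.b h' x; omega
  · right; have := hN.a h' x'; have := hN.b h' x'; omega
  · right; have := hN.c h x'; have := hN.d h x'; have := hN.a h x'; omega
  · right; have := hN.c h (x' + 1); have := hN.d h x'; have := hN.a (h + 1) x'; omega
  · left; have := hN.c h' x'; have := hN.d h' x'; have := hN.a h' x'; omega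
  · left; have := hN.c h' (x + 1); have := hN.d h' x; have := hN.a (h' + 1) x; omega

def ne (P Q : ℕ → ℤ → ℤ) (h : ℕ) (x : ℤ) : Prop := P h x ≠ Q h x

open Classical in
noncomputable def fold (L : ℕ) (o : Pr) : Pr :=
  (fun h x => if ZZ L (ne o.1 o.2) h x then max (o.1 h x) (o.2 h x) else o.1 h x,
   fun h x => if ZZ L (ne o.1 o.2) h x then min (o.1 h x) (o.2 h x) else o.2 h x)

lemma fold_pt (L : ℕ) (o : Pr) (h : ℕ) (x : ℤ) :
    (¬ ZZ L (ne o.1 o.2) h x ∧ (fold L o).1 h x = o.1 h x ∧ (fold L o).2 h x = o.2 h x) ∨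
    (ZZ L (ne o.1 o.2) h x ∧ o.2 h x < o.1 h x ∧ (fold L o).1 h x = o.1 h x ∧ (fold L o).2 h x = o.2 h x) ∨
    (ZZ L (ne o.1 o.2) h x ∧ o.1 h x < o.2 h x ∧ (fold L o).1 h x = o.2 h x ∧ (fold L o).2 h x = o.1 h x) := by
  unfold fold
  by_cases hz : ZZ L (ne o.1 o.2) h x
  · simp only [if_pos hz]
    have := hz.ne
    unfold ne at this
    right
    rcases lt_or_gt_of_ne this with h1 | h1
    · right; exact ⟨hz, h1, by omega, by omega⟩
    · left; exact ⟨hz, h1, by omega, by omega⟩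
  · simp only [if_neg hz]; left; exact ⟨hz, by simp⟩

/-- along an edge, the fold acts uniformly -/
lemma fold_edge {L : ℕ} {o : Pr} (hP : Loc o.1) (hQ : Loc o.2) {h : ℕ} {x : ℤ} {h' : ℕ} {x' : ℤ} (ha : Adj h x h' x') :
    ((fold L o).1 h x - (fold L o).1 h' x' = o.1 h x - o.1 h' x' ∧ (fold L o).2 h x - (fold L o).2 h' x' = o.2 h x - o.2 h' x') ∨
    ((fold L o).1 h x - (fold L o).1 h' x' = o.2 h x - o.2 h' x' ∧ (fold L o).2 h x - (fold L o).2 h' x' = o.1 h x - o.1 h' x') := by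
  have e1 := hP.adj ha
  have e2 := hQ.adj ha
  have p1 := fold_pt L o h x
  have p2 := fold_pt L o h' x'
  have c1 : ZZ L (ne o.1 o.2) h x → ¬ ZZ L (ne o.1 o.2) h' x' → o.1 h' x' = o.2 h' x' := by
    intro z1 z2
    by_contra hn
    exact z2 (ZZ.step _ _ _ _ z1 ha hn)
  have c2 : ZZ L (ne o.1 o.2) h' x' → ¬ ZZ L (ne o.1 o.2) h x → o.1 h x = o.2 h x := by
    intro z1 z2
    by_contra hn
    exact z2 (ZZ.step _ _ _ _ z1 ha.symm hn)
  rcases p1 with p1 | p1 | p1 <;> rcases p2 with p2 | p2 | p2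
  · omega
  · have := c2 p2.1 p1.1; omega
  · have := c2 p2.1 p1.1; omega
  · have := c1 p1.1 p2.1; omega
  · omega
  · omega
  · have := c1 p1.1 p2.1; omega
  · omega
  · omega

lemma fold_loc {L : ℕ} {o : Pr} (hP : Loc o.1) (hQ : Loc o.2) : Loc (fold L o).1 ∧ Loc (fold L o).2 := by
  have E : ∀ h x, Adj h x h (x + 1) := fun h x => by unfold Adj; omega
  have V : ∀ h x, Adj h x (h + 1) x := fun h x => by unfold Adj; omega
  have D : ∀ h x, Adj (h + 1) x h (x + 1) := fun h x => by unfold Adj; omega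
  constructor
  · constructor
    · intro h x; have := fold_edge (L := L) hP hQ (E h x); have := hP.a h x; have := hQ.a h x; omega
    · intro h x; have := fold_edge (L := L) hP hQ (E h x); have := hP.b h x; have := hQ.b h x; omega
    · intro h x; have := fold_edge (L := L) hP hQ (V h x); have := hP.c h x; have := hQ.c h x; omega
    · intro h x; have := fold_edge (L := L) hP hQ (D h x); have := hP.d h x; have := hQ.d h x; omega
  · constructor
    · intro h x; have := fold_edge (L := L) hP hQ (E h x); have := hP.a h x; have := hQ.a h x; omega
    · intro h x; have := fold_edge (L := L) hP hQ (E h x); have := hP.b h x; have := hQ.b h x; omega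
    · intro h x; have := fold_edge (L := L) hP hQ (V h x); have := hP.c h x; have := hQ.c h x; omega
    · intro h x; have := fold_edge (L := L) hP hQ (D h x); have := hP.d h x; have := hQ.d h x; omega

lemma fold_obj {L : ℕ} {P0 P1 Q0 Q1 : ℤ → ℤ} {o : Pr} (h1 : IsObj L P0 P1 o.1) (h2 : IsObj L Q0 Q1 o.2)
    (h0 : ∀ x, Q0 x ≤ P0 x) :
    IsObj L P0 (fun x => max (P1 x) (Q1 x)) (fold L o).1 ∧ IsObj L Q0 (fun x => min (P1 x) (Q1 x)) (fold L o).2 := by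
  have hl := fold_loc (L := L) h1.loc h2.loc
  have hb : ∀ x, (fold L o).1 0 x = P0 x ∧ (fold L o).2 0 x = Q0 x := by
    intro x
    have := fold_pt L o 0 x
    have := h0 x
    rw [h1.bot, h2.bot] at *
    omega
  have ht : ∀ h x, L ≤ h → (fold L o).1 h x = max (P1 x) (Q1 x) ∧ (fold L o).2 h x = min (P1 x) (Q1 x) := by
    intro h x hh
    have hz : o.1 h x ≠ o.2 h x → ZZ L (ne o.1 o.2) h x := fun hn => ZZ.top _ _ hh hn
    have p := fold_pt L o h x
    rw [h1.top h hh, h2.top h hh] at *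
    by_cases e : P1 x = Q1 x
    · omega
    · have := hz e
      rcases p with p | p | p
      · exact absurd this p.1
      · omega
      · omega
  exact ⟨⟨hl.1, funext fun x => (hb x).1, fun h hh => funext fun x => (ht h x hh).1⟩,
    ⟨hl.2, funext fun x => (hb x).2, fun h hh => funext fun x => (ht h x hh).2⟩⟩

lemma fold_sum (L : ℕ) (o : Pr) (h : ℕ) (x : ℤ) : (fold L o).1 h x + (fold L o).2 h x = o.1 h x + o.2 h x := by
  have := fold_pt L o h x
  omega

lemma fold_wt (L : ℕ) (o : Pr) (W : ℤ) (h : ℕ) : wt W (fold L o).1 h + wt W (fold L o).2 h = wt W o.1 h + wt W o.2 h := by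
  unfold wt
  rw [← sum_add_distrib, ← sum_add_distrib]
  refine sum_congr rfl fun y _ => ?_
  have := fold_sum L o h y
  have := fold_sum L o (h + 1) y
  omega

lemma fold_ne (L : ℕ) (o : Pr) : ne (fold L o).1 (fold L o).2 = ne o.1 o.2 := by
  funext h x
  have := fold_pt L o h x
  unfold ne
  apply propext
  omega

lemma fold_inj {L : ℕ} {P0 P1 Q0 Q1 : ℤ → ℤ} {o o' : Pr} (h1 : IsObj L P0 P1 o.1) (h2 : IsObj L Q0 Q1 o.2)
    (h1' : IsObj L P0 P1 o'.1) (h2' : IsObj L Q0 Q1 o'.2) (he : fold L o = fold L o') : o = o' := by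
  have hne : ne o.1 o.2 = ne o'.1 o'.2 := by rw [← fold_ne L o, he, fold_ne]
  have key : ∀ h x, ZZ L (ne o.1 o.2) h x → o.1 h x = o'.1 h x ∧ o.2 h x = o'.2 h x := by
    intro h x hz
    induction hz with
    | top h x hL _ => rw [h1.top h hL, h2.top h hL, h1'.top h hL, h2'.top h hL]; simp
    | step h x h' x' hz ha hn ih =>
      have q1 := fold_pt L o h' x'
      have q2 := fold_pt L o' h' x'
      have n := hz.ne
      rw [← he] at q2
      unfold ne at n hn
      have e1 := h1.loc.adj ha
      have e2 := h2.loc.adj ha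
      have e3 := h1'.loc.adj ha
      have e4 := h2'.loc.adj ha
      omega
  have : ∀ h x, o.1 h x = o'.1 h x ∧ o.2 h x = o'.2 h x := by
    intro h x
    by_cases hz : ZZ L (ne o.1 o.2) h x
    · exact key h x hz
    · have q1 := fold_pt L o h x
      have q2 := fold_pt L o' h x
      rw [← he, ← hne] at q2
      rcases q1 with q1 | q1 | q1
      · rcases q2 with q2 | q2 | q2
        · omega
        · exact absurd q2.1 hz
        · exact absurd q2.1 hz
      · exact absurd q1.1 hz
      · exact absurd q1.1 hz
  exact Prod.ext (funext fun h => funext fun x => (this h x).1) (funext fun h => funext fun x => (this h x).2)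

end FFLP

namespace FFLP
open Finset

/-- abstract data of a cellwise exchange -/
structure Exch (W : ℤ) (P Q P' Q' : ℕ → ℤ → ℤ) : Prop where
  pc : PC W P Q
  pc' : PC W P' Q'
  pt : ∀ h x, (P' h x = P h x ∧ Q' h x = Q h x) ∨ (P' h x = Q h x ∧ Q' h x = P h x)

lemma Exch.swap {W : ℤ} {P Q P' Q' : ℕ → ℤ → ℤ} (h : Exch W P Q P' Q') : Exch W Q P Q' P' :=
  ⟨⟨h.pc.lQ, h.pc.lP, h.pc.wQ, h.pc.wP⟩, ⟨h.pc'.lQ, h.pc'.lP, h.pc'.wQ, h.pc'.wP⟩, fun l x => by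
    have := h.pt l x; omega⟩

lemma CC_swap (W : ℤ) (P Q : ℕ → ℤ → ℤ) (j : ℕ) (x : ℤ) : CC W Q P j x = CC W P Q j x := by
  unfold CC cc
  exact sum_congr rfl fun y _ => by ring

lemma down_ind (p : ℤ → Prop) (W : ℤ) (h0 : ∀ x, W ≤ x → p x) (hs : ∀ x, p (x + 1) → p x) (x : ℤ) : p x := by
  have : ∀ n : ℕ, p (W - n) := by
    intro n
    induction n with
    | zero => exact h0 _ (by simp)
    | succ n ih => apply hs; convert ih using 1; push_cast; ring
  by_cases hx : W ≤ x
  · exact h0 x hx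
  · have := this (W - x).toNat
    rwa [show W - ((W - x).toNat : ℤ) = x by omega] at this

section
variable {W : ℤ} {P Q P' Q' : ℕ → ℤ → ℤ}

lemma Exch.CC_eq (h : Exch W P Q P' Q') (j : ℕ) (x : ℤ) :
    CC W P' Q' j x + kap P' j x + kap Q' j x = CC W P Q j x + kap P j x + kap Q j x := by
  induction x using down_ind (W := W) with
  | h0 x hx =>
    rw [CC_top _ _ _ _ hx, CC_top _ _ _ _ hx, kap_off h.pc.lP h.pc.wP _ _ (Or.inr hx), kap_off h.pc.lQ h.pc.wQ _ _ (Or.inr hx),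
      kap_off h.pc'.lP h.pc'.wP _ _ (Or.inr hx), kap_off h.pc'.lQ h.pc'.wQ _ _ (Or.inr hx)]
  | hs x ih =>
    rw [CC_rec h.pc.wP h.pc.wQ, CC_rec h.pc'.wP h.pc'.wQ]
    have i1 := ff_identity h.pc.lP j x
    have i2 := ff_identity h.pc.lQ j x
    have i3 := ff_identity h.pc'.lP j x
    have i4 := ff_identity h.pc'.lQ j x
    have p0 := h.pt j x
    have p1 := h.pt (j + 1) x
    have p2 := h.pt (j + 2) x
    unfold cc
    have q0 : P' j x + Q' j x = P j x + Q j x := by omega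
    have q1 : P' (j + 1) x + Q' (j + 1) x = P (j + 1) x + Q (j + 1) x := by omega
    have q2 : P' (j + 2) x + Q' (j + 2) x = P (j + 2) x + Q (j + 2) x := by omega
    linarith

/-- the exceptional configuration -/
def cfg (P Q P' Q' : ℕ → ℤ → ℤ) (j : ℕ) (x : ℤ) : Prop :=
  P (j + 2) (x - 1) = P j x + 1 ∧ Q (j + 2) (x - 1) = Q j x + 1 ∧ P j x = Q j x + 1 ∧
    P' (j + 2) (x - 1) - Q' (j + 2) (x - 1) = - (P' j x - Q' j x)

lemma Loc.mid {N : ℕ → ℤ → ℤ} (hN : Loc N) (j : ℕ) (x : ℤ) :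
    N j x ≤ N (j + 1) x ∧ N (j + 1) x ≤ N j x + 1 ∧
    N (j + 1) x ≤ N (j + 2) (x - 1) ∧ N (j + 2) (x - 1) ≤ N (j + 1) x + 1 := by
  have m1 := hN.adj (show Adj (j + 1) x j x by unfold Adj; omega)
  have m2 := hN.adj (show Adj (j + 1) x (j + 2) (x - 1) by unfold Adj; omega)
  omega

lemma PC.adj (h : PC W P Q) {u : ℕ} {x : ℤ} {v : ℕ} {y : ℤ} (ha : Adj u x v y) :
    P u x - Q u x ≤ P v y - Q v y + 1 ∧ P v y - Q v y ≤ P u x - Q u x + 1 := by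
  have a1 := h.lP.adj ha
  have a2 := h.lQ.adj ha
  clear ha
  rcases a1 with a1 | a1 <;> rcases a2 with a2 | a2 <;> omega

lemma Exch.nz (h : Exch W P Q P' Q') {u : ℕ} {x : ℤ} (hn : P u x ≠ Q u x) : P' u x ≠ Q' u x := by
  have := h.pt u x; omega

lemma Exch.same (h : Exch W P Q P' Q') {u : ℕ} {x : ℤ} {v : ℕ} {y : ℤ} (ha : Adj u x v y)
    (h1 : P' u x ≠ Q' u x) (h2 : P' v y ≠ Q' v y) :
    ((P' u x = P u x ∧ Q' u x = Q u x) ∧ (P' v y = P v y ∧ Q' v y = Q v y)) ∨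
    ((P' u x = Q u x ∧ Q' u x = P u x) ∧ (P' v y = Q v y ∧ Q' v y = P v y)) := by
  have a1 := h.pc.adj ha
  have a2 := h.pc'.adj ha
  rcases h.pt u x with p | p <;> rcases h.pt v y with q | q
  · left; exact ⟨p, q⟩
  · omega
  · omega
  · right; exact ⟨p, q⟩

lemma cfg_step (h : Exch W P Q P' Q') (j : ℕ) (x : ℤ) (hc : cfg P Q P' Q' j x) :
    ff Q j x = 1 ∧ (ff P j x = 0 ∨ (ff P j x = -1 ∧ cfg P Q P' Q' j (x + 1))) := by
  obtain ⟨c1, c2, c3, c4⟩ := hc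
  have hP := h.pc.lP
  have hQ := h.pc.lQ
  have e : j + 1 + 1 = j + 2 := rfl
  have pU := h.pt (j + 2) (x - 1)
  have pD := h.pt j x
  have hm : P (j + 1) x = Q (j + 1) x := by
    have pm := h.pt (j + 1) x
    have a1 := h.pc'.lP.mid j x
    have a2 := h.pc'.lQ.mid j x
    rcases pU with pU | pU <;> rcases pD with pD | pD <;> rcases pm with pm | pm <;> omega
  clear pU pD
  have b1 := hP.mid j x
  have b2 := hQ.mid j x
  have hm1 : Q (j + 1) x = Q j x + 1 := by omega
  have d1 := hQ.d j x
  have d2 := hQ.a j x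
  have d3 := hQ.c (j + 1) x
  have d4 := hQ.a (j + 2) (x - 1)
  rw [sub_add_cancel] at d4
  rw [e] at d3
  have fQ : fr Q j x := ⟨by omega, by omega, by omega⟩
  constructor
  · unfold ff; rw [if_pos fQ]; omega
  · rcases ff_cases hP j x with g | g | g
    · left; exact g.2
    · omega
    · right
      refine ⟨g.2.1, ?_⟩
      obtain ⟨⟨g1, g2, g3⟩, _, _⟩ := g
      obtain ⟨k1, k2, k3⟩ := fQ
      have n1 : Adj (j + 2) (x - 1) (j + 2) x := by unfold Adj; omega
      have n2 : Adj j x j (x + 1) := by unfold Adj; omega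
      have r1 := h.same n1 (h.nz (by omega)) (h.nz (by omega))
      have r2 := h.same n2 (h.nz (by omega)) (h.nz (by omega))
      have z : P' (j + 2) x - Q' (j + 2) x = -(P' j (x + 1) - Q' j (x + 1)) := by
        rcases r1 with r1 | r1 <;> rcases r2 with r2 | r2 <;> omega
      unfold cfg
      rw [add_sub_cancel_right]
      exact ⟨by omega, by omega, by omega, z⟩

lemma cfg_CC (h : Exch W P Q P' Q') (j : ℕ) (hC : ∀ x, 0 ≤ CC W P Q j x) (x : ℤ) (hc : cfg P Q P' Q' j x) :
    1 ≤ CC W P Q j x := by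
  induction x using down_ind (W := W) with
  | h0 x hx =>
    have h1 := (cfg_step h j x hc).1
    have h2 := ff_off h.pc.wQ j x (Or.inr hx)
    omega
  | hs x ih =>
    have h1 := cfg_step h j x hc
    have r := CC_rec h.pc.wP h.pc.wQ j x
    rw [cc] at r
    have := hC (x + 1)
    rcases h1 with ⟨h1, h2 | ⟨h2, h3⟩⟩
    · omega
    · have := ih h3; omega

lemma kap_cases (N : ℕ → ℤ → ℤ) (j : ℕ) (x : ℤ) :
    (N (j + 2) (x - 1) = N j x + 2 ∧ kap N j x = 1) ∨ (N (j + 2) (x - 1) ≠ N j x + 2 ∧ kap N j x = 0) := by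
  unfold kap; split_ifs <;> simp_all

lemma Loc.two {N : ℕ → ℤ → ℤ} (hN : Loc N) (j : ℕ) (x : ℤ) : N j x ≤ N (j + 2) (x - 1) ∧ N (j + 2) (x - 1) ≤ N j x + 2 := by
  have m1 := hN.adj (show Adj (j + 1) x j x by unfold Adj; omega)
  have m2 := hN.adj (show Adj (j + 1) x (j + 2) (x - 1) by unfold Adj; omega)
  omega

lemma Exch.CC_nonneg (h : Exch W P Q P' Q') (j : ℕ) (hC : ∀ x, 0 ≤ CC W P Q j x) (x : ℤ) : 0 ≤ CC W P' Q' j x := by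
  have e := h.CC_eq j x
  have k1 := kap_cases P j x
  have k2 := kap_cases Q j x
  have k3 := kap_cases P' j x
  have k4 := kap_cases Q' j x
  have t1 := h.pc.lP.two j x
  have t2 := h.pc.lQ.two j x
  have t3 := h.pc'.lP.two j x
  have t4 := h.pc'.lQ.two j x
  have pU := h.pt (j + 2) (x - 1)
  have pD := h.pt j x
  have := hC x
  by_cases hk : kap P' j x + kap Q' j x ≤ kap P j x + kap Q j x
  · omega
  · have c1 : kap P' j x + kap Q' j x = kap P j x + kap Q j x + 1 ∧ P (j + 2) (x - 1) = P j x + 1 ∧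
        Q (j + 2) (x - 1) = Q j x + 1 ∧ (P j x = Q j x + 1 ∨ Q j x = P j x + 1) ∧
        P' (j + 2) (x - 1) - Q' (j + 2) (x - 1) = - (P' j x - Q' j x) := by
      clear e this
      rcases pU with pU | pU <;> rcases pD with pD | pD <;> rcases k1 with k1 | k1 <;> rcases k2 with k2 | k2 <;>
        rcases k3 with k3 | k3 <;> rcases k4 with k4 | k4 <;> first | omega | (exfalso; omega)
    clear k1 k2 k3 k4 t1 t2 t3 t4 pU pD hk
    obtain ⟨c1, c2, c3, c4, c5⟩ := c1
    have c0 : kap P' j x + kap Q' j x = kap P j x + kap Q j x + 1 ∧ (cfg P Q P' Q' j x ∨ cfg Q P Q' P' j x) := by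
      refine ⟨c1, ?_⟩
      rcases c4 with c4 | c4
      · left; exact ⟨c2, c3, c4, c5⟩
      · right; exact ⟨c3, c2, c4, by omega⟩
    rcases c0.2 with c | c
    · have := cfg_CC h j hC x c; omega
    · have := cfg_CC h.swap j (fun y => by rw [CC_swap]; exact hC y) x c
      rw [CC_swap] at this
      omega

/-- closed set of cells -/
structure MM (W : ℤ) (P Q : ℕ → ℤ → ℤ) (j : ℕ) (y : ℤ) : Prop where
  f1 : fr P j y
  f2 : fr Q j y
  eq : P j y = Q j y
  l1 : ff P j y = -1
  l2 : ff Q j y = 1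
  c0 : CC W P Q j (y + 1) = 0

lemma MM.east (hpc : PC W P Q) {j : ℕ} (hC : ∀ x, 0 ≤ CC W P Q j x) {y : ℤ} (m : MM W P Q j y)
    (hn : P (j + 1) (y + 1) ≠ Q (j + 1) (y + 1)) : MM W P Q j (y + 1) := by
  obtain ⟨f1, f2, eq, l1, l2, c0⟩ := m
  have g1 := ff_cases hpc.lP j y
  have g2 := ff_cases hpc.lQ j y
  have a1 := hpc.lP.a (j + 1) y
  have a2 := hpc.lP.c j (y + 1)
  have a3 := hpc.lQ.a (j + 1) y
  have a4 := hpc.lQ.c j (y + 1)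
  have e1 := f1.1
  have e2 := f2.1
  have hP : P (j + 1) (y + 1) = P j (y + 1) := by omega
  have fQ : fr Q j (y + 1) := by
    by_contra hh
    have := next_of_not_fr hpc.lQ f2 hh
    omega
  have r := CC_rec hpc.wP hpc.wQ j (y + 1)
  rw [cc] at r
  have := hC (y + 1 + 1)
  have k1 := ff_cases hpc.lP j (y + 1)
  have k2 := ff_cases hpc.lQ j (y + 1)
  rcases k2 with k2 | k2 | k2
  · exact absurd fQ k2.1
  · rcases k1 with k1 | k1 | k1
    · omega
    · omega
    · exact ⟨k1.1, fQ, by omega, k1.2.1, k2.2.1, by omega⟩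
  · omega

lemma MM.west (hpc : PC W P Q) {j : ℕ} (hC : ∀ x, 0 ≤ CC W P Q j x) {y : ℤ} (m : MM W P Q j (y + 1))
    (hn : P (j + 1) y ≠ Q (j + 1) y) : MM W P Q j y := by
  obtain ⟨f1, f2, eq, l1, l2, c0⟩ := m
  have g1 := ff_cases hpc.lP j (y + 1)
  have g2 := ff_cases hpc.lQ j (y + 1)
  have a1 := hpc.lP.c (j + 1) y
  have a2 := hpc.lP.a (j + 1) y
  have a3 := hpc.lQ.c (j + 1) y
  have a4 := hpc.lQ.a (j + 1) y
  have e1 := f1.2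
  have e2 := f2.2
  rw [add_sub_cancel_right] at e1 e2
  have e : j + 1 + 1 = j + 2 := rfl
  rw [e] at a1 a3
  have hQ : Q (j + 1) y = Q j (y + 1) + 1 := by omega
  have fP : fr P j y := by
    by_contra hh
    have := prev_of_not_fr hpc.lP f1 hh
    omega
  have r := CC_rec hpc.wP hpc.wQ j y
  have r2 := CC_rec hpc.wP hpc.wQ j (y + 1)
  rw [cc] at r r2
  have := hC y
  have k1 := ff_cases hpc.lP j y
  have k2 := ff_cases hpc.lQ j y
  have e3 := fP.1
  rcases k1 with k1 | k1 | k1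
  · exact absurd fP k1.1
  · omega
  · rcases k2 with k2 | k2 | k2
    · omega
    · have := k2.1.1
      exact ⟨fP, k2.1, by omega, k1.2.1, k2.2.1, by omega⟩
    · have := k2.1.1; omega

lemma MM.not_ZZ {L : ℕ} (hpc : PC W P Q) {j : ℕ} (hj : j + 1 < L) (hC : ∀ x, 0 ≤ CC W P Q j x)
    {h : ℕ} {y : ℤ} (hz : ZZ L (ne P Q) h y) : h = j + 1 → ¬ MM W P Q j y := by
  induction hz with
  | top h x hL _ => intro e; omega
  | step h x h' x' hz ha hn ih =>
    rintro rfl m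
    have hn0 := hz.ne
    unfold ne at hn0 hn
    obtain ⟨f11, f12, f13⟩ := m.f1
    obtain ⟨f21, f22, f23⟩ := m.f2
    have eq := m.eq
    rcases ha with ⟨rfl, rfl | rfl⟩ | ⟨h1, rfl | rfl⟩ | ⟨rfl, rfl | rfl⟩
    · exact ih rfl (MM.west hpc hC m hn0)
    · exact ih rfl (MM.east hpc hC m hn0)
    · have : h = j := by omega
      subst this; omega
    · have : h = j := by omega
      subst this; omega
    · have e : j + 1 + 1 = j + 2 := rfl
      rw [e] at hn0; omega
    · have e : j + 1 + 1 = j + 2 := rfl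
      rw [add_sub_cancel_right] at f12 f22
      rw [e] at hn0; omega

end

section
variable {L : ℕ} {W : ℤ} {P Q P' Q' : ℕ → ℤ → ℤ}

lemma kap_fr {N : ℕ → ℤ → ℤ} {j : ℕ} {x : ℤ} (hf : fr N j x) : kap N j (x + 1) = 0 := by
  obtain ⟨h1, h2, h3⟩ := hf
  unfold kap
  rw [add_sub_cancel_right, if_neg (by omega)]

lemma fr_of_eq {N M : ℕ → ℤ → ℤ} {j : ℕ} {x : ℤ} (hf : fr N j x) (h1 : N j x = M j x) (h2 : N j (x + 1) = M j (x + 1))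
    (h4 : N (j + 2) (x - 1) = M (j + 2) (x - 1)) (h5 : N (j + 2) x = M (j + 2) x) : fr M j x := by
  unfold fr at *; omega

lemma ff_of_fr {N : ℕ → ℤ → ℤ} {j : ℕ} {x : ℤ} (hf : fr N j x) : ff N j x = 2 * (N (j + 1) x - N j x) - 1 := by
  unfold ff; rw [if_pos hf]

lemma fr_of_ff {N : ℕ → ℤ → ℤ} {j : ℕ} {x : ℤ} (hf : ff N j x ≠ 0) : fr N j x := by
  by_contra h; exact hf (by unfold ff; rw [if_neg h])

set_option maxHeartbeats 2000000 in
lemma Exch.hw (h : Exch W P Q P' Q') (hz : ∀ h x, (P' h x = P h x ∧ Q' h x = Q h x) ∨ ZZ L (ne P Q) h x)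
    (hw : HW L W P Q) : HW L W P' Q' := by
  intro j x hj hb
  have hC : ∀ x, 0 ≤ CC W P Q j x := by
    intro y
    by_contra hn
    exact hw j y hj (Or.inl (by omega))
  rcases hb with hb | ⟨hb1, hb2⟩
  · have := h.CC_nonneg j hC x; omega
  · have F1 : fr P' j x := fr_of_ff (by omega)
    have F2 : fr Q' j x := fr_of_ff (by omega)
    have e1 := ff_of_fr F1
    have e2 := ff_of_fr F2
    have eC := h.CC_eq j (x + 1)
    rw [kap_fr F1, kap_fr F2] at eC
    obtain ⟨p1, p2, p3⟩ := F1
    obtain ⟨q1, q2, q3⟩ := F2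
    have n1 : Adj (j + 1) x j x := by unfold Adj; omega
    have n2 : Adj (j + 1) x j (x + 1) := by unfold Adj; omega
    have n3 : Adj (j + 1) x (j + 2) (x - 1) := by unfold Adj; omega
    have n4 : Adj (j + 1) x (j + 2) x := by unfold Adj; omega
    have hCx := hC (x + 1)
    by_cases hg : P' j x = Q' j x
    · have hb3 : ff P' j x = 1 ∧ ff Q' j x = -1 := by
        rcases hb2 with hb2 | hb2
        · exact hb2.2
        · omega
      clear hb2
      have t0 := h.pt (j + 1) x
      have t1 : P' j x = P j x ∧ Q' j x = Q j x := by have := h.pt j x; omega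
      have t2 : P' j (x + 1) = P j (x + 1) ∧ Q' j (x + 1) = Q j (x + 1) := by have := h.pt j (x + 1); omega
      have t3 : P' (j + 2) (x - 1) = P (j + 2) (x - 1) ∧ Q' (j + 2) (x - 1) = Q (j + 2) (x - 1) := by
        have := h.pt (j + 2) (x - 1); omega
      have t4 : P' (j + 2) x = P (j + 2) x ∧ Q' (j + 2) x = Q (j + 2) x := by
        have := h.pt (j + 2) x; omega
      have G1 : fr P j x := by unfold fr; omega
      have G2 : fr Q j x := by unfold fr; omega
      rw [kap_fr G1, kap_fr G2] at eC
      have k1 := ff_of_fr G1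
      have k2 := ff_of_fr G2
      rcases t0 with t0 | t0
      · exact hw j x hj (Or.inr ⟨by omega, Or.inl (by omega)⟩)
      · have hM : MM W P Q j x := ⟨G1, G2, by omega, by omega, by omega, by omega⟩
        rcases hz (j + 1) x with hz | hz
        · omega
        · exact MM.not_ZZ h.pc hj hC hz rfl hM
    · have hg0 : P' (j + 1) x ≠ Q' (j + 1) x := by
        rcases hb2 with hb2 | hb2 <;> omega
      have s1 := h.same n1 hg0 (by clear hb2 e1 e2 eC; omega)
      have s2 := h.same n2 hg0 (by clear hb2 e1 e2 eC; omega)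
      have s3 := h.same n3 hg0 (by clear hb2 e1 e2 eC; omega)
      have s4 := h.same n4 hg0 (by clear hb2 e1 e2 eC; omega)
      have s : ((P' j x = P j x ∧ Q' j x = Q j x) ∧ (P' j (x + 1) = P j (x + 1) ∧ Q' j (x + 1) = Q j (x + 1)) ∧
          (P' (j + 2) (x - 1) = P (j + 2) (x - 1) ∧ Q' (j + 2) (x - 1) = Q (j + 2) (x - 1)) ∧
          (P' (j + 2) x = P (j + 2) x ∧ Q' (j + 2) x = Q (j + 2) x) ∧
          (P' (j + 1) x = P (j + 1) x ∧ Q' (j + 1) x = Q (j + 1) x)) ∨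
          ((P' j x = Q j x ∧ Q' j x = P j x) ∧ (P' j (x + 1) = Q j (x + 1) ∧ Q' j (x + 1) = P j (x + 1)) ∧
          (P' (j + 2) (x - 1) = Q (j + 2) (x - 1) ∧ Q' (j + 2) (x - 1) = P (j + 2) (x - 1)) ∧
          (P' (j + 2) x = Q (j + 2) x ∧ Q' (j + 2) x = P (j + 2) x) ∧
          (P' (j + 1) x = Q (j + 1) x ∧ Q' (j + 1) x = P (j + 1) x)) := by
        have h0 := hg0
        clear hb1 hb2 e1 e2 eC p1 p2 p3 q1 q2 q3 hg
        rcases s1 with ⟨u0, s1⟩ | ⟨u0, s1⟩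
        · left
          refine ⟨s1, ?_, ?_, ?_, u0⟩
          · rcases s2 with s2 | s2
            · exact s2.2
            · omega
          · rcases s3 with s2 | s2
            · exact s2.2
            · omega
          · rcases s4 with s2 | s2
            · exact s2.2
            · omega
        · right
          refine ⟨s1, ?_, ?_, ?_, u0⟩
          · rcases s2 with s2 | s2
            · omega
            · exact s2.2
          · rcases s3 with s2 | s2
            · omega
            · exact s2.2
          · rcases s4 with s2 | s2
            · omega
            · exact s2.2
      clear s1 s2 s3 s4
      have G1 : fr P j x := by clear hb2 e1 e2 eC; unfold fr; rcases s with s | s <;> omega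
      have G2 : fr Q j x := by clear hb2 e1 e2 eC; unfold fr; rcases s with s | s <;> omega
      rw [kap_fr G1, kap_fr G2] at eC
      have k1 := ff_of_fr G1
      have k2 := ff_of_fr G2
      clear p1 p2 p3 q1 q2 q3
      refine hw j x hj (Or.inr ⟨by omega, ?_⟩)
      rcases s with s | s
      · rw [k1, k2, ← s.1.1, ← s.1.2, ← s.2.2.2.2.1, ← s.2.2.2.2.2, ← e1, ← e2]; exact hb2
      · rw [k1, k2, ← s.1.1, ← s.1.2, ← s.2.2.2.2.1, ← s.2.2.2.2.2, ← e1, ← e2]; omega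

end
end FFLP

namespace FFLP
open Finset

lemma nn_zero (N : ℕ) : IsSchurNonneg N 0 :=
  ⟨0, Fin.elim0, Fin.elim0, Fin.elim0, fun i => i.elim0, fun i => i.elim0, by simp⟩

lemma nn_add {N : ℕ} {f g : MvPolynomial (Fin N) ℤ} (hf : IsSchurNonneg N f) (hg : IsSchurNonneg N g) :
    IsSchurNonneg N (f + g) := by
  obtain ⟨m, c, k, l, h1, h2, rfl⟩ := hf
  obtain ⟨m', c', k', l', h1', h2', rfl⟩ := hg
  refine ⟨m + m', Fin.append c c', Fin.append k k', Fin.append l l', ?_, ?_, ?_⟩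
  · intro i
    refine Fin.addCases (fun i => ?_) (fun i => ?_) i
    · simpa using h1 i
    · simpa using h1' i
  · intro i
    refine Fin.addCases (fun i => ?_) (fun i => ?_) i
    · simpa using h2 i
    · simpa using h2' i
  · rw [Fin.sum_univ_add]
    simp

lemma nn_single {N k : ℕ} {l : ℕ → ℕ} (hl : Antitone l) (hk : ∀ j, k ≤ j → l j = 0) :
    IsSchurNonneg N (skewSchur N k l (fun _ => 0)) :=
  ⟨1, fun _ => 1, fun _ => k, fun _ => l, fun _ => hl, fun _ => hk, by simp⟩

lemma nn_sum {N : ℕ} {α : Type*} (s : Finset α) (f : α → MvPolynomial (Fin N) ℤ)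
    (h : ∀ a ∈ s, IsSchurNonneg N (f a)) : IsSchurNonneg N (∑ a ∈ s, f a) := by
  classical
  induction s using Finset.induction_on with
  | empty => simpa using nn_zero N
  | insert a s ha ih =>
    rw [sum_insert ha]
    exact nn_add (h _ (mem_insert_self _ _)) (ih fun b hb => h _ (mem_insert_of_mem hb))

section
variable {L : ℕ} {P0 P1 Q0 Q1 : ℤ → ℤ} {W : ℤ}

lemma nn_JT (hW0 : 0 ≤ W) {o : Pr} (hpc : PC W o.1 o.2) (h : HW L W o.1 o.2) :
    IsSchurNonneg L (JT (xv L) L L (fun i => (pw W o i : ℤ) - i)) := by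
  have e : JT (xv L) L L (fun i => (pw W o i : ℤ) - i) =
      skewSchur L L (fun j => if j < L then pw W o j else 0) (fun _ => 0) := by
    rw [skewSchur_eq]
    unfold JT
    congr 1
    ext i j : 2
    simp
  rw [e]
  refine nn_single (antitone_nat_of_succ_le fun j => ?_) (fun j hj => if_neg (by omega))
  by_cases hj : j + 1 < L
  · rw [if_pos hj, if_pos (by omega)]
    exact HW_anti hW0 hpc h j hj
  · rw [if_neg hj]; exact Nat.zero_le _

theorem generic (hW0 : 0 ≤ W) (hP : AgreeOff W P0 P1) (hQ : AgreeOff W Q0 Q1) (h0 : ∀ x, Q0 x ≤ P0 x)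
    (hF : (GF (xv L) W L P0 P1 * GF (xv L) W L Q0 Q1).IsSymmetric)
    (hF' : (GF (xv L) W L P0 (fun x => max (P1 x) (Q1 x)) * GF (xv L) W L Q0 (fun x => min (P1 x) (Q1 x))).IsSymmetric) :
    IsSchurNonneg L (GF (xv L) W L P0 (fun x => max (P1 x) (Q1 x)) * GF (xv L) W L Q0 (fun x => min (P1 x) (Q1 x))
      - GF (xv L) W L P0 P1 * GF (xv L) W L Q0 Q1) := by
  classical
  have hP' : AgreeOff W P0 (fun x => max (P1 x) (Q1 x)) := fun x hx => by
    have := hP x hx; have := hQ x hx; have := h0 x; dsimp only; omega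
  have hQ' : AgreeOff W Q0 (fun x => min (P1 x) (Q1 x)) := fun x hx => by
    have := hP x hx; have := hQ x hx; have := h0 x; dsimp only; omega
  rw [GF_mul hP hQ hF, GF_mul hP' hQ' hF']
  set A := {o ∈ X L P0 P1 ×ˢ X L Q0 Q1 | HW L W o.1 o.2} with hA
  set B := {o ∈ X L P0 (fun x => max (P1 x) (Q1 x)) ×ˢ X L Q0 (fun x => min (P1 x) (Q1 x)) | HW L W o.1 o.2} with hB
  have mA : ∀ o ∈ A, IsObj L P0 P1 o.1 ∧ IsObj L Q0 Q1 o.2 ∧ PC W o.1 o.2 ∧ HW L W o.1 o.2 := by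
    intro o ho
    rw [hA, mem_filter] at ho
    have := obj_pc hP hQ ho.1
    have h2 := ho.1
    rw [mem_product, mem_X hP, mem_X hQ] at h2
    exact ⟨h2.1, h2.2, this, ho.2⟩
  have key : ∀ o ∈ A, fold L o ∈ B ∧ ∀ i, pw W (fold L o) i = pw W o i := by
    intro o ho
    obtain ⟨o1, o2, hpc, hw⟩ := mA o ho
    have hf := fold_obj o1 o2 h0
    have hm : fold L o ∈ X L P0 (fun x => max (P1 x) (Q1 x)) ×ˢ X L Q0 (fun x => min (P1 x) (Q1 x)) := by
      rw [mem_product, mem_X hP', mem_X hQ']; exact hf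
    have hpc' := obj_pc hP' hQ' hm
    constructor
    · rw [hB, mem_filter]
      refine ⟨hm, Exch.hw (P := o.1) (Q := o.2) ⟨hpc, hpc', fun h x => ?_⟩ (fun h x => ?_) hw⟩
      · rcases fold_pt L o h x with h | h | h
        · exact Or.inl h.2
        · exact Or.inl h.2.2
        · exact Or.inr h.2.2
      · rcases fold_pt L o h x with h | h | h
        · exact Or.inl h.2
        · exact Or.inl h.2.2
        · exact Or.inr h.1
    · intro i
      have e1 := pw_eq hpc i
      have e2 := pw_eq hpc' i
      have e3 := fold_wt L o W i
      omega
  have inj : Set.InjOn (fold L) A := by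
    intro o ho o' ho' he
    obtain ⟨a, b, _⟩ := mA o ho
    obtain ⟨a', b', _⟩ := mA o' ho'
    exact fold_inj a b a' b' he
  have e : ∑ o ∈ A, JT (xv L) L L (fun i => (pw W o i : ℤ) - i) =
      ∑ o ∈ A.image (fold L), JT (xv L) L L (fun i => (pw W o i : ℤ) - i) := by
    rw [sum_image inj]
    refine sum_congr rfl fun o ho => ?_
    simp only [(key o ho).2]
  have hsub : A.image (fold L) ⊆ B := by
    intro o ho
    obtain ⟨o', h', rfl⟩ := mem_image.1 ho
    exact (key o' h').1
  rw [e, ← sum_sdiff hsub, add_sub_cancel_right]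
  refine nn_sum _ _ fun o ho => ?_
  have := (mem_sdiff.1 ho).1
  rw [hB, mem_filter] at this
  exact nn_JT hW0 (obj_pc hP' hQ' this.1) this.2

end
end FFLP

namespace FFLP
open Finset

/-- shifted positions of the rows of a partition -/
def pos (l : ℕ → ℕ) (i : ℕ) : ℤ := (l i : ℤ) - i

structure Part (k : ℕ) (l : ℕ → ℕ) : Prop where
  anti : Antitone l
  zero : ∀ j, k ≤ j → l j = 0

lemma Part.sd {k : ℕ} {l : ℕ → ℕ} (h : Part k l) : SD k (pos l) := by
  refine ⟨fun i _ => ?_, ?_⟩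
  · have := h.anti (Nat.le_succ i); simp only [pos, Nat.succ_eq_add_one] at *; push_cast; omega
  · simp [pos, h.zero k le_rfl]

lemma GF_schur (N : ℕ) {k : ℕ} {l : ℕ → ℕ} (h : Part k l) (c e W : ℤ) (hk : -W ≤ -k + c) (hl : l 0 + c ≤ W) :
    GF (xv N) W N (prof k c e (fun i => -(i : ℤ))) (prof k c e (pos l)) = skewSchur N k l (fun _ => 0) ∧
    AgreeOff W (prof k c e (fun i => -(i : ℤ))) (prof k c e (pos l)) := by
  have hp : ∀ r, r < k → pos l r + c ≤ W := fun r _ => by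
    have := h.anti (Nat.zero_le r); unfold pos; omega
  exact ⟨by rw [GF_eq_JT (xv N) k c e W hk N _ h.sd hp, skewSchur_eq]; rfl, agree h.sd c e W hk hp⟩

lemma max_prof {k : ℕ} {l m : ℕ → ℕ} (hl : Part k l) (hm : Part k m)
    (h1 : Part k (fun i => max (l i) (m i))) (h2 : Part k (fun i => min (l i) (m i))) :
    (fun x => max (prof k 0 0 (pos l) x) (prof k 0 0 (pos m) x)) = prof k 0 0 (pos fun i => max (l i) (m i)) ∧
    (fun x => min (prof k 0 0 (pos l) x) (prof k 0 0 (pos m) x)) = prof k 0 0 (pos fun i => min (l i) (m i)) := by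
  constructor
  all_goals
    funext x
    have a1 := prof_ge k 0 0 (pos l) x
    have a2 := prof_le k 0 0 (pos l) x
    have b1 := prof_ge k 0 0 (pos m) x
    have b2 := prof_le k 0 0 (pos m) x
    refine eq_of_iff (k := k) (e := 0) (by omega) (by omega) (prof_ge _ _ _ _ _) (prof_le _ _ _ _ _) fun r hr => ?_
    have i1 := prof_le_iff hl.sd 0 0 x r hr
    have i2 := prof_le_iff hm.sd 0 0 x r hr
    first
    | rw [prof_le_iff h1.sd 0 0 x r hr, max_le_iff, i1, i2]
      unfold pos; push_cast; omega
    | rw [prof_le_iff h2.sd 0 0 x r hr, min_le_iff, i1, i2]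
      unfold pos; push_cast; omega

theorem app1 (N : ℕ) {k : ℕ} {l m : ℕ → ℕ} (hl : Part k l) (hm : Part k m)
    (h1 : Part k (fun i => max (l i) (m i))) (h2 : Part k (fun i => min (l i) (m i))) :
    IsSchurNonneg N (skewSchur N k (fun i => max (l i) (m i)) (fun _ => 0) * skewSchur N k (fun i => min (l i) (m i)) (fun _ => 0)
      - skewSchur N k l (fun _ => 0) * skewSchur N k m (fun _ => 0)) := by
  obtain ⟨W, hW⟩ : ∃ W : ℤ, W = k + l 0 + m 0 := ⟨_, rfl⟩
  obtain ⟨e1, A1⟩ := GF_schur N hl 0 0 W (by omega) (by omega)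
  obtain ⟨e2, A2⟩ := GF_schur N hm 0 0 W (by omega) (by omega)
  obtain ⟨e3, -⟩ := GF_schur N h1 0 0 W (by omega) (by push_cast; omega)
  obtain ⟨e4, -⟩ := GF_schur N h2 0 0 W (by omega) (by push_cast; omega)
  obtain ⟨f1, f2⟩ := max_prof hl hm h1 h2
  have := generic (L := N) (W := W) (by omega) A1 A2 (fun _ => le_rfl)
  rw [f1, f2, e1, e2, e3, e4] at this
  exact this ((skewSchur_symm _ _ _).mul (skewSchur_symm _ _ _)) ((skewSchur_symm _ _ _).mul (skewSchur_symm _ _ _))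

/-- the second factor after the shifted step -/
def low (l m : ℕ → ℕ) : ℕ → ℕ
  | 0 => l 0
  | i + 1 => min (l (i + 1)) (m i)

lemma bot_le (k : ℕ) (x : ℤ) : prof k 1 0 (fun i => -(i : ℤ)) x ≤ prof k 0 1 (fun i => -(i : ℤ)) x := by
  have a1 := prof_ge k 0 1 (fun i => -(i : ℤ)) x
  have b2 := prof_le k 1 0 (fun i => -(i : ℤ)) x
  by_contra hn
  push Not at hn
  obtain ⟨r, hr⟩ : ∃ r : ℕ, prof k 0 1 (fun i => -(i : ℤ)) x = 1 + r :=
    ⟨(prof k 0 1 (fun i => -(i : ℤ)) x - 1).toNat, by omega⟩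
  have i1 := prof_le_iff (SD_zero k) 0 1 x r (by omega)
  have i2 := prof_le_iff (SD_zero k) 1 0 x (r + 1) (by omega)
  push_cast at i2
  omega

lemma max_prof2 {k : ℕ} {l m : ℕ → ℕ} (hl : Part k l) (hm : Part k m)
    (h1 : Part k (fun i => max (m i) (l (i + 1)))) (h2 : Part k (low l m)) :
    (fun x => max (prof k 0 1 (pos m) x) (prof k 1 0 (pos l) x)) = prof k 0 1 (pos fun i => max (m i) (l (i + 1))) ∧
    (fun x => min (prof k 0 1 (pos m) x) (prof k 1 0 (pos l) x)) = prof k 1 0 (pos (low l m)) := by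
  constructor
  · funext x
    have a1 := prof_ge k 1 0 (pos l) x
    have a2 := prof_le k 1 0 (pos l) x
    have b1 := prof_ge k 0 1 (pos m) x
    have b2 := prof_le k 0 1 (pos m) x
    refine eq_of_iff (k := k) (e := 1) (by omega) (by omega) (prof_ge _ _ _ _ _) (prof_le _ _ _ _ _) fun r hr => ?_
    have i2 := prof_le_iff hm.sd 0 1 x r hr
    rw [prof_le_iff h1.sd 0 1 x r hr, max_le_iff, i2]
    by_cases hr' : r + 1 < k
    · have i1 := prof_le_iff hl.sd 1 0 x (r + 1) hr'
      rw [show (1 : ℤ) + r = 0 + ((r + 1 : ℕ) : ℤ) by push_cast; ring, i1]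
      unfold pos; push_cast; omega
    · have := hl.zero (r + 1) (by omega)
      unfold pos at *; push_cast; rw [this]; push_cast; omega
  · funext x
    have a1 := prof_ge k 1 0 (pos l) x
    have a2 := prof_le k 1 0 (pos l) x
    have b1 := prof_ge k 0 1 (pos m) x
    have b2 := prof_le k 0 1 (pos m) x
    refine eq_of_iff (k := k) (e := 0) (by omega) (by omega) (prof_ge _ _ _ _ _) (prof_le _ _ _ _ _) fun r hr => ?_
    have i1 := prof_le_iff hl.sd 1 0 x r hr
    rw [prof_le_iff h2.sd 1 0 x r hr, min_le_iff, i1]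
    cases r with
    | zero => simp only [pos, low] at *; push_cast; omega
    | succ s =>
      have i2 := prof_le_iff hm.sd 0 1 x s (by omega)
      rw [show (0 : ℤ) + ((s + 1 : ℕ) : ℤ) = 1 + s by push_cast; ring, i2]
      simp only [pos, low]; push_cast; omega

theorem app2 (N : ℕ) {k : ℕ} {l m : ℕ → ℕ} (hl : Part k l) (hm : Part k m)
    (h1 : Part k (fun i => max (m i) (l (i + 1)))) (h2 : Part k (low l m)) :
    IsSchurNonneg N (skewSchur N k (low l m) (fun _ => 0) * skewSchur N k (fun i => max (m i) (l (i + 1))) (fun _ => 0)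
      - skewSchur N k l (fun _ => 0) * skewSchur N k m (fun _ => 0)) := by
  obtain ⟨W, hW⟩ : ∃ W : ℤ, W = k + l 0 + m 0 + 1 := ⟨_, rfl⟩
  have ha := hl.anti (Nat.zero_le 1)
  obtain ⟨e1, A1⟩ := GF_schur N hl 1 0 W (by omega) (by omega)
  obtain ⟨e2, A2⟩ := GF_schur N hm 0 1 W (by omega) (by omega)
  obtain ⟨e3, -⟩ := GF_schur N h1 0 1 W (by omega) (by simp only [zero_add]; push_cast; omega)
  obtain ⟨e4, -⟩ := GF_schur N h2 1 0 W (by omega) (by simp only [low]; omega)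
  obtain ⟨f1, f2⟩ := max_prof2 hl hm h1 h2
  have := generic (L := N) (W := W) (by omega) A2 A1 (bot_le k)
  rw [f1, f2, e1, e2, e3, e4] at this
  rw [mul_comm (skewSchur N k (low l m) _), mul_comm (skewSchur N k l _)]
  exact this ((skewSchur_symm _ _ _).mul (skewSchur_symm _ _ _)) ((skewSchur_symm _ _ _).mul (skewSchur_symm _ _ _))

end FFLP

namespace FFLP
open Finset

lemma anti_le {n : ℕ} {a b : ℕ → ℕ} (ha : Antitone a) (hb : Antitone b)
    (h : ∀ f : ℕ → ℕ, ∑ i ∈ range n, f (a i) = ∑ i ∈ range n, f (b i)) (i : ℕ) (hi : i < n) : a i ≤ b i := by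
  by_contra hn
  push Not at hn
  have := h (fun v => if a i ≤ v then 1 else 0)
  rw [sum_boole, sum_boole] at this
  have h1 : range (i + 1) ⊆ {j ∈ range n | a i ≤ a j} := by
    intro j hj
    rw [mem_range] at hj
    rw [mem_filter, mem_range]
    exact ⟨by omega, ha (by omega)⟩
  have h2 : {j ∈ range n | a i ≤ b j} ⊆ range i := by
    intro j hj
    rw [mem_filter] at hj
    rw [mem_range]
    by_contra hji
    have := hb (show i ≤ j by omega)
    omega
  have h3 := card_le_card h1
  have h4 := card_le_card h2
  rw [card_range] at h3 h4
  simp only [Nat.cast_id] at this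
  omega

/-- interleaving of two sequences -/
def inter (l m : ℕ → ℕ) (i : ℕ) : ℕ := if i % 2 = 0 then l (i / 2) else m (i / 2)

lemma inter_even (l m : ℕ → ℕ) (i : ℕ) : inter l m (2 * i) = l i := by
  unfold inter; rw [if_pos (by omega)]; congr 1; omega

lemma inter_odd (l m : ℕ → ℕ) (i : ℕ) : inter l m (2 * i + 1) = m i := by
  unfold inter; rw [if_neg (by omega)]; congr 1; omega

lemma sum_inter (f : ℕ → ℕ) (k : ℕ) (s : ℕ → ℕ) :
    ∑ i ∈ range (2 * k), f (s i) = ∑ i ∈ range k, (f (s (2 * i)) + f (s (2 * i + 1))) := by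
  induction k with
  | zero => simp
  | succ k ih => rw [show 2 * (k + 1) = 2 * k + 1 + 1 by ring, sum_range_succ, sum_range_succ, ih, sum_range_succ]; ring

lemma sum_low (g : ℕ → ℕ → ℕ) (k : ℕ) (l m : ℕ → ℕ) (hl : Part k l) :
    ∑ i ∈ range k, g i (l i) + g k 0 = g 0 (l 0) + ∑ i ∈ range k, g (i + 1) (l (i + 1)) := by
  have := sum_range_succ (fun i => g i (l i)) k
  rw [sum_range_succ', hl.zero k le_rfl] at this
  omega

lemma part_low {k : ℕ} {l m : ℕ → ℕ} (hl : Part k l) (hm : Part k m) : Part k (low l m) := by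
  refine ⟨antitone_nat_of_succ_le fun j => ?_, fun j hj => ?_⟩
  · have h1 := hl.anti (Nat.le_succ j)
    cases j with
    | zero => simp only [low, Nat.succ_eq_add_one] at *; omega
    | succ j =>
      have h2 := hm.anti (Nat.le_succ j)
      simp only [low, Nat.succ_eq_add_one] at *; omega
  · have h1 := hl.zero j hj
    cases j with
    | zero => exact h1
    | succ j => simp only [low]; omega

theorem main (N k : ℕ) (s : ℕ → ℕ) (hs : Antitone s) (hs0 : ∀ j, 2 * k ≤ j → s j = 0) (M : ℕ) :
    ∀ l m : ℕ → ℕ, Part k l → Part k m →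
    (∀ f : ℕ → ℕ, ∑ i ∈ range (2 * k), f (s i) = ∑ i ∈ range k, (f (l i) + f (m i))) →
    ∑ i ∈ range k, (2 * i * l i + (2 * i + 1) * m i) = M →
    IsSchurNonneg N (skewSchur N k (fun j => s (2 * j)) (fun _ => 0) * skewSchur N k (fun j => s (2 * j + 1)) (fun _ => 0)
        - skewSchur N k l (fun _ => 0) * skewSchur N k m (fun _ => 0)) := by
  induction M using Nat.strong_induction_on with
  | _ M ih =>
  intro l m hl hm hsum hM
  by_cases c1 : ∃ i, l i < m i
  · have p1 : Part k (fun i => max (l i) (m i)) :=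
      ⟨fun i j h => max_le_max (hl.anti h) (hm.anti h), fun j hj => by simp [hl.zero j hj, hm.zero j hj]⟩
    have p2 : Part k (fun i => min (l i) (m i)) :=
      ⟨fun i j h => min_le_min (hl.anti h) (hm.anti h), fun j hj => by simp [hl.zero j hj, hm.zero j hj]⟩
    have := ih _ (?_) _ _ p1 p2 (fun f => ?_) rfl
    · have := nn_add this (app1 N hl hm p1 p2)
      rwa [sub_add_sub_cancel] at this
    · rw [← hM]
      obtain ⟨i, hi⟩ := c1
      have hik : i < k := by
        by_contra h
        have := hm.zero i (by omega); omega
      refine sum_lt_sum (fun j _ => ?_) ⟨i, mem_range.2 hik, ?_⟩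
      · rcases le_total (l j) (m j) with h | h
        · rw [max_eq_right h, min_eq_left h]; nlinarith
        · rw [max_eq_left h, min_eq_right h]
      · rw [max_eq_right hi.le, min_eq_left hi.le]; nlinarith
    · rw [hsum f]
      refine sum_congr rfl fun j _ => ?_
      rcases le_total (l j) (m j) with h | h
      · rw [max_eq_right h, min_eq_left h, add_comm]
      · rw [max_eq_left h, min_eq_right h]
  by_cases c2 : ∃ i, m i < l (i + 1)
  · have p1 : Part k (fun i => max (m i) (l (i + 1))) :=
      ⟨fun i j h => max_le_max (hm.anti h) (hl.anti (by omega)), fun j hj => by simp [hl.zero (j + 1) (by omega), hm.zero j hj]⟩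
    have p2 := part_low hl hm
    have := ih _ (?_) _ _ p2 p1 (fun f => ?_) rfl
    · have := nn_add this (app2 N hl hm p1 p2)
      rwa [sub_add_sub_cancel] at this
    · rw [← hM]
      obtain ⟨i, hi⟩ := c2
      have hik : i < k := by
        by_contra h
        have := hl.zero (i + 1) (by omega); omega
      have e1 := sum_low (fun i v => 2 * i * v) k l m hl
      have e2 := sum_low (fun i v => 2 * i * v) k (low l m) m p2
      rw [sum_add_distrib, sum_add_distrib]
      have e3 : ∑ j ∈ range k, (2 * (j + 1) * low l m (j + 1) + (2 * j + 1) * max (m j) (l (j + 1))) <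
          ∑ j ∈ range k, (2 * (j + 1) * l (j + 1) + (2 * j + 1) * m j) := by
        refine sum_lt_sum (fun j _ => ?_) ⟨i, mem_range.2 hik, ?_⟩
        · simp only [low]
          rcases le_total (m j) (l (j + 1)) with h | h
          · rw [max_eq_right h, min_eq_right h]; nlinarith
          · rw [max_eq_left h, min_eq_left h]
        · simp only [low]
          rw [max_eq_right hi.le, min_eq_right hi.le]; nlinarith
      rw [sum_add_distrib, sum_add_distrib] at e3
      simp only [mul_zero, zero_mul, zero_add, add_zero] at e1 e2
      omega
    · rw [hsum f, sum_add_distrib, sum_add_distrib]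
      have e1 := sum_low (fun _ v => f v) k l m hl
      have e2 := sum_low (fun _ v => f v) k (low l m) m p2
      have e3 : ∑ j ∈ range k, (f (low l m (j + 1)) + f (max (m j) (l (j + 1)))) =
          ∑ j ∈ range k, (f (l (j + 1)) + f (m j)) := by
        refine sum_congr rfl fun j _ => ?_
        simp only [low]
        rcases le_total (m j) (l (j + 1)) with h | h
        · rw [max_eq_right h, min_eq_right h, add_comm]
        · rw [max_eq_left h, min_eq_left h]
      rw [sum_add_distrib, sum_add_distrib] at e3
      have e0 : low l m 0 = l 0 := rfl
      rw [e0] at e2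
      omega
  push Not at c1 c2
  have ht : Antitone (inter l m) := antitone_nat_of_succ_le fun j => by
    obtain ⟨i, rfl | rfl⟩ : ∃ i, j = 2 * i ∨ j = 2 * i + 1 := ⟨j / 2, by omega⟩
    · rw [inter_odd, inter_even]; exact c1 i
    · rw [inter_odd, show 2 * i + 1 + 1 = 2 * (i + 1) by ring, inter_even]; exact c2 i
  have hst : ∀ f : ℕ → ℕ, ∑ i ∈ range (2 * k), f (s i) = ∑ i ∈ range (2 * k), f (inter l m i) := by
    intro f
    rw [hsum f, sum_inter f k (inter l m)]
    simp only [inter_even, inter_odd]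
  have e : ∀ i, i < 2 * k → s i = inter l m i := fun i hi =>
    le_antisymm (anti_le hs ht hst i hi) (anti_le ht hs (fun f => (hst f).symm) i hi)
  have el : (fun j => s (2 * j)) = l := by
    funext j
    by_cases h : j < k
    · rw [e _ (by omega), inter_even]
    · rw [hs0 _ (by omega), hl.zero j (by omega)]
  have em : (fun j => s (2 * j + 1)) = m := by
    funext j
    by_cases h : j < k
    · rw [e _ (by omega), inter_odd]
    · rw [hs0 _ (by omega), hm.zero j (by omega)]
  rw [el, em, sub_self]
  exact nn_zero N

end FFLP

theorem fomin_fulton_li_poon_conjecture (k : ℕ) (lam mu : ℕ → ℕ)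
    (hlam : Antitone lam) (hmu : Antitone mu)
    (hlamk : ∀ j, k ≤ j → lam j = 0) (hmuk : ∀ j, k ≤ j → mu j = 0)
    (sigma : ℕ → ℕ) (hsigma : Antitone sigma)
    (hsigmak : ∀ j, 2 * k ≤ j → sigma j = 0)
    (hunion : (Finset.range (2 * k)).val.map sigma
      = (Finset.range k).val.map lam + (Finset.range k).val.map mu)
    (N : ℕ) :
    IsSchurNonneg N
      (skewSchur N k (fun j => sigma (2 * j)) (fun _ => 0)
          * skewSchur N k (fun j => sigma (2 * j + 1)) (fun _ => 0)
        - skewSchur N k lam (fun _ => 0) * skewSchur N k mu (fun _ => 0)) := by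
  refine FFLP.main N k sigma hsigma hsigmak _ lam mu ⟨hlam, hlamk⟩ ⟨hmu, hmuk⟩ (fun f => ?_) rfl
  have := congrArg (fun t => (Multiset.map f t).sum) hunion
  simp only [Multiset.map_add, Multiset.sum_add, Multiset.map_map] at this
  rw [Finset.sum_add_distrib]
  exact this
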